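/- Assume gcd(s+l,2l) = 2·gcd(s,l), and write d = gcd(s,l). Let i = p^{s−1}(p−1)(p^s + 1) and λ = p^{s+3d−1}·[p^{s−1}(p−1)(p^s + 1) − 1]·(p^m − p^{m−2d} − p^{m−3d} + p^s − p^{s−d} + 1)/((p^d + 1)(p^{2d} − 1)). Then the distinct supports of the codewords of Hamming weight i in C form a 2-(p^m, i, λ) design on the point set F_q: each such support has exactly i elements, and every 2-element subset of F_q is contained in exactly λ of the distinct supports. -/

import Mathlib

/-- `trp p r z = z + z^p + ⋯ + z^(p^(r-1))`, the trace form used for `Tr_r`. -/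
def trp (p r : ℕ) {F : Type} [Field F] (z : F) : F :=
  ∑ i ∈ Finset.range r, z ^ p ^ i

/-- The codeword `c(a,b,c,h)` of the code `C`, viewed as a function on `F_q = F`;
its value at `x` is `Tr_s(a x^(p^s+1)) + Tr_m(b x^(p^l+1) + c x) + h` (the values
lie in the prime field `F_p ⊆ F`). Here `m = 2s`. -/
def cword (p s l : ℕ) {F : Type} [Field F] (a b c : F) (h : ZMod p) : F → F :=
  fun x => trp p s (a * x ^ (p ^ s + 1)) + trp p (2 * s) (b * x ^ (p ^ l + 1) + c * x)
    + ZMod.cast h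

/-- The support of the codeword `c(a,b,c,h)`; its cardinality is the Hamming weight. -/
def suppw (p s l : ℕ) {F : Type} [Field F] [Fintype F] [DecidableEq F]
    (a b c : F) (h : ZMod p) : Finset F :=
  Finset.univ.filter fun x => cword p s l a b c h x ≠ 0

/-- The number of points at which `f` takes the value `v`. -/
def levelCard {X Y : Type*} [Fintype X] [DecidableEq Y] (f : X → Y) (v : Y) : ℕ :=
  (Finset.univ.filter fun x => f x = v).card

section LevelCard

variable {p : ℕ} [Fact p.Prime]

lemma sum_levelCard {X Y : Type*} [Fintype X] [Fintype Y] [DecidableEq Y] (f : X → Y) :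
    ∑ v, levelCard f v = Fintype.card X := by
  simpa [levelCard] using
    (Finset.card_eq_sum_card_fiberwise (f := f) (s := Finset.univ) (t := Finset.univ)
      (fun _ _ => Finset.mem_coe.2 (Finset.mem_univ _))).symm

lemma levelCard_comp_equiv {X X' Y : Type*} [Fintype X] [Fintype X'] [DecidableEq Y]
    (f : X → Y) (e : X' ≃ X) (v : Y) : levelCard (fun x => f (e x)) v = levelCard f v := by
  unfold levelCard
  refine Finset.card_bij (fun x _ => e x) ?_ ?_ ?_
  · simp
  · intro a _ b _ h
    exact e.injective h
  · intro b hb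
    exact ⟨e.symm b, by simpa using hb, by simp⟩

lemma sum_comp_eq_sum_levelCard {X Y : Type*} [Fintype X] [Fintype Y] [DecidableEq Y]
    (f : X → Y) (g : Y → ℂ) : ∑ x, g (f x) = ∑ v, (levelCard f v : ℂ) * g v := by
  rw [← Finset.sum_fiberwise (s := Finset.univ) (g := f)]
  refine Finset.sum_congr rfl fun v _ => ?_
  rw [Finset.sum_congr rfl (g := fun _ => g v)]
  · simp [levelCard]
  · intro x hx
    rw [(Finset.mem_filter.1 hx).2]

/-- The difference between the number of zeros of `Q` and the number of times it is `1`. -/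
def levelDiff {X : Type*} [Fintype X] (Q : X → ZMod p) : ℤ :=
  (levelCard Q 0 : ℤ) - levelCard Q 1

lemma sum_addChar_eq_levelDiff {X : Type*} [Fintype X] {Q : X → ZMod p}
    (hQ : ∀ v, v ≠ 0 → levelCard Q v = levelCard Q 1) {χ : AddChar (ZMod p) ℂ} (hχ : χ ≠ 1) :
    ∑ x, χ (Q x) = levelDiff Q := by
  rw [sum_comp_eq_sum_levelCard Q χ]
  have h0 := AddChar.sum_eq_zero_of_ne_one hχ
  rw [← Finset.add_sum_erase _ _ (Finset.mem_univ (0 : ZMod p))] at h0 ⊢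
  rw [Finset.sum_congr rfl (g := fun v => (levelCard Q 1 : ℂ) * χ v)]
  · rw [← Finset.mul_sum, eq_neg_of_add_eq_zero_right h0]
    simp [levelDiff]
    ring
  · intro v hv
    rw [hQ v (Finset.ne_of_mem_erase hv)]

lemma mul_levelCard_eq {X : Type*} [Fintype X] {Q : X → ZMod p}
    (hQ : ∀ v, v ≠ 0 → levelCard Q v = levelCard Q 1) (v : ZMod p) :
    (p : ℤ) * levelCard Q v =
      Fintype.card X + (if v = 0 then (p : ℤ) - 1 else -1) * levelDiff Q := by
  have h : (levelCard Q 0 : ℤ) + ((p : ℤ) - 1) * levelCard Q 1 = Fintype.card X := by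
    rw [← sum_levelCard Q, ← Finset.add_sum_erase _ _ (Finset.mem_univ (0 : ZMod p)),
      Finset.sum_congr rfl (g := fun _ => levelCard Q 1)]
    · have := (Fact.out : p.Prime).one_le
      simp [Finset.card_erase_of_mem, ZMod.card, Nat.cast_sub this]
    · intro v hv
      rw [hQ v (Finset.ne_of_mem_erase hv)]
  split_ifs with hv
  · subst hv
    rw [levelDiff, ← h]
    ring
  · rw [hQ v hv, levelDiff, ← h]
    ring

end LevelCard

section QuadraticFunction

variable {p : ℕ} [Fact p.Prime] {F : Type*} [Field F] [Fintype F]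
  [Algebra (ZMod p) F]

lemma exists_trace_mul_ne_zero {a : F} (ha : a ≠ 0) :
    ∃ b : F, Algebra.trace (ZMod p) F (b * a) ≠ 0 := by
  have htr := (traceForm_nondegenerate (ZMod p) F).1 a
  simp_rw [Algebra.traceForm_apply] at htr
  by_contra! hf
  exact ha (htr fun y => by rw [mul_comm]; exact hf y)

lemma exists_addChar_ne_one {χ : AddChar (ZMod p) ℂ} (hχ : χ ≠ 1) {v : ZMod p} (hv : v ≠ 0) :
    ∃ t : ZMod p, χ (t * v) ≠ 1 := by
  obtain ⟨u, hu⟩ := AddChar.ne_one_iff.1 hχ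
  exact ⟨u * v⁻¹, by rwa [inv_mul_cancel_right₀ hv]⟩

lemma sum_addChar_trace_mul [DecidableEq F] {χ : AddChar (ZMod p) ℂ} (hχ : χ ≠ 1) (w : F) :
    ∑ y : F, χ (Algebra.trace (ZMod p) F (y * w)) = if w = 0 then (Fintype.card F : ℂ) else 0 := by
  split_ifs with hw
  · simp [hw]
  · let ψ : AddChar F ℂ := χ.compAddMonoidHom
      ((Algebra.trace (ZMod p) F).toAddMonoidHom.comp (AddMonoidHom.mulRight w))
    have hψ : ψ ≠ 1 := by
      obtain ⟨b, hb⟩ := exists_trace_mul_ne_zero (p := p) hw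
      obtain ⟨t, ht⟩ := exists_addChar_ne_one hχ hb
      refine AddChar.ne_one_iff.2 ⟨t • b, ?_⟩
      have : Algebra.trace (ZMod p) F (t • b * w) = t * Algebra.trace (ZMod p) F (b * w) := by
        rw [smul_mul_assoc, map_smul, smul_eq_mul]
      change χ (Algebra.trace (ZMod p) F (t • b * w)) ≠ 1
      rwa [this]
    exact AddChar.sum_eq_zero_of_ne_one hψ

/-- `Q` is a quadratic function whose polar form is `(x, y) ↦ Tr (x * L y)`. -/
structure IsQuadWith (Q : F → ZMod p) (L : F →ₗ[ZMod p] F) : Prop where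
  map_add : ∀ x y, Q (x + y) = Q x + Q y + Algebra.trace (ZMod p) F (x * L y)
  map_neg : ∀ x, Q (-x) = Q x
  levelCard_eq : ∀ v, v ≠ 0 → levelCard Q v = levelCard Q 1

namespace IsQuadWith

variable {Q : F → ZMod p} {L : F →ₗ[ZMod p] F}

lemma map_zero (h : IsQuadWith Q L) : Q 0 = 0 := by
  have := h.map_add 0 0
  simpa using this

lemma trace_mul_comm (h : IsQuadWith Q L) (x y : F) :
    Algebra.trace (ZMod p) F (x * L y) = Algebra.trace (ZMod p) F (y * L x) := by
  have h1 := h.map_add x y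
  have h2 := h.map_add y x
  rw [add_comm y x, h1, add_comm (Q y)] at h2
  exact add_left_cancel h2

lemma apply_of_map_eq_zero (h : IsQuadWith Q L) (hp : Odd p) {r : F} (hr : L r = 0) : Q r = 0 := by
  have h1 := h.map_add (-r) r
  rw [neg_add_cancel, h.map_zero, h.map_neg, hr, mul_zero, _root_.map_zero, add_zero] at h1
  have h2 : (2 : ZMod p) ≠ 0 := by
    refine Ring.two_ne_zero ?_
    rw [ZMod.ringChar_zmod_n]
    rintro rfl
    exact absurd hp (by decide)
  have h3 : 2 * Q r = 0 := by rw [two_mul]; exact h1.symm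
  exact (mul_eq_zero.1 h3).resolve_left h2

lemma levelDiff_sq (h : IsQuadWith Q L) (hp : Odd p) :
    levelDiff Q ^ 2 = Fintype.card F * Nat.card (LinearMap.ker L) := by
  classical
  obtain ⟨χ, hχ⟩ : ∃ χ : AddChar (ZMod p) ℂ, χ ≠ 1 :=
    ⟨ZMod.stdAddChar, by
      simpa using (ZMod.isPrimitive_stdAddChar p) (one_ne_zero)⟩
  have hχ' : χ⁻¹ ≠ 1 := inv_ne_one.2 hχ
  have key : ((levelDiff Q ^ 2 : ℤ) : ℂ) = Fintype.card F * Nat.card (LinearMap.ker L) := by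
    push_cast
    rw [sq]
    nth_rw 1 [← sum_addChar_eq_levelDiff h.levelCard_eq hχ]
    rw [← sum_addChar_eq_levelDiff h.levelCard_eq hχ', Finset.sum_mul_sum, Finset.sum_comm]
    have h1 : ∀ y : F, ∑ x : F, χ (Q x) * χ⁻¹ (Q y)
        = ∑ z : F, χ (Q z) * χ (Algebra.trace (ZMod p) F (y * L z)) := by
      intro y
      rw [← Equiv.sum_comp (Equiv.addRight y)]
      refine Finset.sum_congr rfl fun z _ => ?_
      rw [Equiv.coe_addRight, AddChar.inv_apply, ← AddChar.map_add_eq_mul,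
        ← AddChar.map_add_eq_mul, h.map_add, h.trace_mul_comm z y]
      congr 1
      ring
    simp_rw [h1]
    rw [Finset.sum_comm]
    simp_rw [← Finset.mul_sum, sum_addChar_trace_mul hχ]
    have h2 : ∀ z : F, χ (Q z) * (if L z = 0 then (Fintype.card F : ℂ) else 0)
        = if L z = 0 then (Fintype.card F : ℂ) else 0 := by
      intro z
      split_ifs with hz
      · rw [h.apply_of_map_eq_zero hp hz, AddChar.map_zero_eq_one, one_mul]
      · rw [mul_zero]
    simp_rw [h2]
    rw [← Finset.sum_filter, Finset.sum_const, nsmul_eq_mul, mul_comm]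
    congr 2
    exact (Nat.subtype_card _ (by simp)).symm
  exact_mod_cast key

/-- The elements trace-orthogonal to the radical are in the range of `L`. -/
lemma mem_range_of_orthogonal (h : IsQuadWith Q L) {c : F}
    (hc : ∀ r, L r = 0 → Algebra.trace (ZMod p) F (c * r) = 0) : ∃ z, L z = c := by
  let B := Algebra.traceForm (ZMod p) F
  have hB : B.Nondegenerate := traceForm_nondegenerate (ZMod p) F
  have hle : LinearMap.range L ≤ B.orthogonal (LinearMap.ker L) := by
    rintro _ ⟨z, rfl⟩ r hr
    change Algebra.trace (ZMod p) F (r * L z) = 0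
    rw [h.trace_mul_comm, LinearMap.mem_ker.1 hr, mul_zero, _root_.map_zero]
  have hfin : Module.finrank (ZMod p) (LinearMap.range L)
      = Module.finrank (ZMod p) (B.orthogonal (LinearMap.ker L)) := by
    rw [LinearMap.BilinForm.finrank_orthogonal hB, ← LinearMap.finrank_range_add_finrank_ker L]
    omega
  have heq := Submodule.eq_of_le_of_finrank_eq hle hfin
  have : c ∈ B.orthogonal (LinearMap.ker L) := by
    intro r hr
    change Algebra.trace (ZMod p) F (r * c) = 0
    rw [mul_comm]
    exact hc r hr
  rw [← heq] at this
  exact this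

/-- Either a translate by a linear form is equidistributed, or completing the square works. -/
lemma levelCard_add_linear (h : IsQuadWith Q L) (hp : Odd p) (c : F) :
    ((∃ r, L r = 0 ∧ Algebra.trace (ZMod p) F (c * r) ≠ 0) ∧ ∀ v, p *
      levelCard (fun x => Q x + Algebra.trace (ZMod p) F (c * x)) v = Fintype.card F) ∨
    ((∀ r, L r = 0 → Algebra.trace (ZMod p) F (c * r) = 0) ∧ ∃ w, ∀ v,
      levelCard (fun x => Q x + Algebra.trace (ZMod p) F (c * x)) v = levelCard Q (v + w)) := by
  by_cases hc : ∀ r, L r = 0 → Algebra.trace (ZMod p) F (c * r) = 0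
  · refine Or.inr ⟨hc, ?_⟩
    obtain ⟨z, rfl⟩ := h.mem_range_of_orthogonal hc
    refine ⟨Q z, fun v => ?_⟩
    rw [← levelCard_comp_equiv Q (Equiv.addRight z)]
    unfold levelCard
    congr 1
    ext x
    simp only [Equiv.coe_addRight, h.map_add, Finset.mem_filter, Finset.mem_univ, true_and]
    rw [mul_comm (L z) x]
    constructor
    · rintro rfl
      ring
    · intro hx
      linear_combination hx
  · refine Or.inl ⟨by push Not at hc; exact hc, ?_⟩
    push Not at hc
    obtain ⟨r, hr, hcr⟩ := hc
    set g : F → ZMod p := fun x => Q x + Algebra.trace (ZMod p) F (c * x) with hg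
    have hconst : ∀ v w, levelCard g v = levelCard g w := by
      intro v w
      set t := (v - w) * (Algebra.trace (ZMod p) F (c * r))⁻¹ with ht
      rw [← levelCard_comp_equiv g (Equiv.addRight (t • r)) v]
      refine congrArg Finset.card (Finset.filter_congr fun x _ => ?_)
      have : g (x + t • r) = g x + (v - w) := by
        have hL : L (t • r) = 0 := by rw [map_smul, hr, smul_zero]
        have h0 : Q (t • r) = 0 := h.apply_of_map_eq_zero hp hL
        simp only [hg]
        rw [h.map_add, hL, h0, mul_zero, _root_.map_zero, mul_add, _root_.map_add,
          mul_smul_comm, map_smul, smul_eq_mul, ht, inv_mul_cancel_right₀ hcr]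
        ring
      change g (x + t • r) = v ↔ _
      rw [this]
      constructor
      · intro hx
        linear_combination hx
      · intro hx
        linear_combination hx
    intro v
    rw [← sum_levelCard g, Finset.sum_congr rfl (fun w _ => hconst w v)]
    simp [ZMod.card]

end IsQuadWith

end QuadraticFunction

section FrobeniusPowers

lemma pow_pow_gcd_eq_self {M : Type*} [Monoid M] {p m n : ℕ} {x : M}
    (hm : x ^ p ^ m = x) (hn : x ^ p ^ n = x) : x ^ p ^ Nat.gcd m n = x := by
  have key : ∀ k, (fun y : M => y ^ p)^[k] x = x ^ p ^ k := fun k => by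
    rw [pow_iterate]
  have h1 : Function.IsPeriodicPt (fun y : M => y ^ p) m x := (key m).trans hm
  have h2 : Function.IsPeriodicPt (fun y : M => y ^ p) n x := (key n).trans hn
  exact (key _).symm.trans (h1.gcd h2)

lemma pow_pow_mul_eq_self {M : Type*} [Monoid M] {p e : ℕ} {x : M} (h : x ^ p ^ e = x) (k : ℕ) :
    x ^ p ^ (e * k) = x := by
  induction k with
  | zero => simp
  | succ k ih => rw [Nat.mul_succ, pow_add, pow_mul, ih, h]

lemma pow_pow_add_mul_eq {M : Type*} [Monoid M] {p e : ℕ} {x : M} (h : x ^ p ^ e = x) (d k : ℕ) :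
    x ^ p ^ (d + e * k) = x ^ p ^ d := by
  rw [add_comm, pow_add, pow_mul, pow_pow_mul_eq_self h]

lemma exists_eq_add_mul_of_gcd {s l d : ℕ} (hl : 1 ≤ l) (hd : Nat.gcd s l = d)
    (hd' : Nat.gcd (s + l) (2 * l) = 2 * d) :
    ∃ j k, s = d + 2 * d * j ∧ l = d + 2 * d * k := by
  have hd0 : 0 < d := hd ▸ Nat.gcd_pos_of_pos_right s hl
  obtain ⟨s', hs'⟩ : d ∣ s := hd ▸ Nat.gcd_dvd_left s l
  obtain ⟨l', hl'⟩ : d ∣ l := hd ▸ Nat.gcd_dvd_right s l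
  have hco : Nat.gcd s' l' = 1 := by
    rw [hs', hl', Nat.gcd_mul_left] at hd
    exact Nat.eq_of_mul_eq_mul_left hd0 (by rw [hd, mul_one])
  obtain ⟨w, hw⟩ : 2 * d ∣ s + l := hd' ▸ Nat.gcd_dvd_left _ _
  have hsum : s' + l' = 2 * w := by
    refine Nat.eq_of_mul_eq_mul_left hd0 ?_
    rw [mul_add, ← hs', ← hl', hw]
    ring
  have hodd : s' % 2 = 1 := by
    by_contra h
    have h1 : 2 ∣ Nat.gcd s' l' := Nat.dvd_gcd (by omega) (by omega)
    rw [hco] at h1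
    omega
  refine ⟨s' / 2, l' / 2, ?_, ?_⟩
  · have : s' = 1 + 2 * (s' / 2) := by omega
    rw [hs']
    nth_rw 1 [this]
    ring
  · have : l' = 1 + 2 * (l' / 2) := by omega
    rw [hl']
    nth_rw 1 [this]
    ring

lemma pow_add_one_dvd_pow_add_one (p d j : ℕ) : p ^ d + 1 ∣ p ^ (d + 2 * d * j) + 1 := by
  have h := Odd.nat_add_dvd_pow_add_pow (p ^ d) 1 (n := 1 + 2 * j) (by simp)
  rw [one_pow, ← pow_mul] at h
  convert h using 3
  ring

end FrobeniusPowers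

section PowerMaps

variable {F : Type*} [Field F] [Fintype F]

lemma card_filter_pow_eq_pow [DecidableEq F] {n : ℕ} (hn : n ∣ Fintype.card F - 1)
    {u : F} (hu : u ≠ 0) : (Finset.univ.filter fun x : F => x ^ n = u ^ n).card = n := by
  have hq : 0 < Fintype.card F - 1 := Nat.sub_pos_of_lt Fintype.one_lt_card
  have hn0 : n ≠ 0 := by
    rintro rfl
    exact hq.ne' (Nat.eq_zero_of_zero_dvd hn)
  have h := IsCyclic.card_powMonoidHom_ker (G := Fˣ) n
  rw [Nat.card_units, Nat.card_eq_fintype_card (α := F), Nat.gcd_eq_right hn] at h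
  have hmem : ∀ ζ : (powMonoidHom n : Fˣ →* Fˣ).ker,
      ((ζ : Fˣ) : F) * u ∈ Finset.univ.filter fun x : F => x ^ n = u ^ n := by
    intro ζ
    have h1 : (ζ : Fˣ) ^ n = 1 := ζ.2
    have h2 : ((ζ : Fˣ) : F) ^ n = 1 := by rw [← Units.val_pow_eq_pow_val, h1, Units.val_one]
    simp [mul_pow, h2]
  conv_rhs => rw [← h]
  rw [← Fintype.card_coe, ← Nat.card_eq_fintype_card]
  refine (Nat.card_congr (Equiv.ofBijective
    (fun ζ : (powMonoidHom n : Fˣ →* Fˣ).ker => ⟨((ζ : Fˣ) : F) * u, hmem ζ⟩) ⟨?_, ?_⟩)).symm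
  · intro a b hab
    have := Subtype.ext_iff.1 hab
    exact Subtype.ext (Units.ext (mul_right_cancel₀ hu this))
  · rintro ⟨x, hx⟩
    have hx' : x ^ n = u ^ n := (Finset.mem_filter.1 hx).2
    have hx0 : x ≠ 0 := by
      rintro rfl
      rw [zero_pow hn0] at hx'
      exact pow_ne_zero n hu hx'.symm
    refine ⟨⟨Units.mk0 (x / u) (div_ne_zero hx0 hu), ?_⟩, ?_⟩
    · refine Units.ext ?_
      change (x / u) ^ n = 1
      rw [div_pow, hx', div_self (pow_ne_zero n hu)]
    · exact Subtype.ext (div_mul_cancel₀ x hu)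

lemma exists_pow_eq_of_pow_eq_one {n k : ℕ} (hk : 0 < k) (hnk : n * k ∣ Fintype.card F - 1)
    {c : F} (hc : c ^ k = 1) : ∃ u : F, u ^ n = c := by
  have hc0 : c ≠ 0 := by
    rintro rfl
    rw [zero_pow hk.ne'] at hc
    exact zero_ne_one hc
  obtain ⟨g, hg⟩ := IsCyclic.exists_generator (α := Fˣ)
  obtain ⟨j, hj⟩ := (mem_powers_iff_mem_zpowers.2 (hg (Units.mk0 c hc0)))
  have hj' : g ^ j = Units.mk0 c hc0 := hj
  have ho : orderOf g = Fintype.card F - 1 := by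
    rw [orderOf_eq_card_of_forall_mem_zpowers hg, Nat.card_units, Nat.card_eq_fintype_card]
  have h1 : g ^ (j * k) = 1 := by
    rw [pow_mul, hj']
    exact Units.ext (by simpa using hc)
  have h2 : n * k ∣ j * k := hnk.trans (ho ▸ orderOf_dvd_of_pow_eq_one h1)
  obtain ⟨i, rfl⟩ := Nat.dvd_of_mul_dvd_mul_right hk h2
  refine ⟨((g ^ i : Fˣ) : F), ?_⟩
  rw [← Units.val_pow_eq_pow_val, ← pow_mul, mul_comm i n, hj', Units.val_mk0]

lemma dvd_card_filter_of_factors_pow [DecidableEq F] {Y : Type*} [DecidableEq Y] {n : ℕ}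
    (hn : n ∣ Fintype.card F - 1) {f : F → Y} (hf : ∀ x y, x ^ n = y ^ n → f x = f y) (v : Y) :
    n ∣ (Finset.univ.filter fun x => x ≠ 0 ∧ f x = v).card := by
  have hq : 0 < Fintype.card F - 1 := Nat.sub_pos_of_lt Fintype.one_lt_card
  have hn0 : n ≠ 0 := by
    rintro rfl
    exact hq.ne' (Nat.eq_zero_of_zero_dvd hn)
  rw [Finset.card_eq_sum_card_image (fun x : F => x ^ n)]
  refine Finset.dvd_sum fun y hy => ?_
  obtain ⟨u, hu, rfl⟩ := Finset.mem_image.1 hy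
  obtain ⟨hu0, huv⟩ := (Finset.mem_filter.1 hu).2
  refine dvd_of_eq (((card_filter_pow_eq_pow hn hu0).symm).trans (congrArg Finset.card ?_))
  ext x
  simp only [Finset.mem_filter, Finset.mem_univ, true_and]
  refine ⟨fun hx => ⟨⟨?_, (hf x u hx).trans huv⟩, hx⟩, fun hx => hx.2⟩
  rintro rfl
  rw [zero_pow hn0] at hx
  exact pow_ne_zero n hu0 hx.symm

lemma dvd_levelDiff_sub_one [DecidableEq F] {p : ℕ} [Fact p.Prime] {n : ℕ}
    (hn : n ∣ Fintype.card F - 1)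
    {f : F → ZMod p} (hf : ∀ x y, x ^ n = y ^ n → f x = f y) (h0 : f 0 = 0) :
    (n : ℤ) ∣ levelDiff f - 1 := by
  have e0 : levelCard f 0 = (Finset.univ.filter fun x => x ≠ 0 ∧ f x = 0).card + 1 := by
    have : (Finset.univ.filter fun x => f x = 0)
        = insert 0 (Finset.univ.filter fun x => x ≠ 0 ∧ f x = 0) := by
      ext x
      by_cases hx : x = 0 <;> simp [hx, h0]
    rw [levelCard, this, Finset.card_insert_of_notMem (by simp)]
  have e1 : levelCard f 1 = (Finset.univ.filter fun x => x ≠ 0 ∧ f x = 1).card := by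
    unfold levelCard
    congr 1
    ext x
    by_cases hx : x = 0 <;> simp [hx, h0]
  rw [levelDiff, e0, e1]
  push_cast
  have h2 := Int.natCast_dvd_natCast.2 (dvd_card_filter_of_factors_pow hn hf 0)
  have h3 := Int.natCast_dvd_natCast.2 (dvd_card_filter_of_factors_pow hn hf 1)
  rw [add_sub_right_comm, add_sub_cancel_right]
  exact dvd_sub h2 h3

end PowerMaps

section PossibleValues

lemma eq_of_dvd_of_pow_lt {p d f : ℕ} (hp : 3 ≤ p) (hfd : f < d) {ε : ℤ}
    (hε : ε = 1 ∨ ε = -1) (h : ((p : ℤ) ^ d + 1) ∣ ε * (p : ℤ) ^ f + 1) : f = 0 ∧ ε = -1 := by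
  have hlt : (p : ℤ) ^ f < (p : ℤ) ^ d := pow_lt_pow_right₀ (by omega) hfd
  have hpos : (1 : ℤ) ≤ (p : ℤ) ^ f := one_le_pow₀ (by omega)
  rcases hε with rfl | rfl
  · have := Int.le_of_dvd (by omega) h
    omega
  · have h0 : (-1 * (p : ℤ) ^ f + 1) = 0 := by
      refine Int.eq_zero_of_abs_lt_dvd h ?_
      rw [abs_lt]
      constructor <;> omega
    refine ⟨?_, rfl⟩
    by_contra hf
    have : (1 : ℤ) < (p : ℤ) ^ f := one_lt_pow₀ (by omega) hf
    omega

lemma value_cases {p s d j R : ℕ} {T : ℤ} (hp : p.Prime) (hp3 : 3 ≤ p) (hd : 0 < d)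
    (hs : s = d + 2 * d * j) (hT : T ^ 2 = (p ^ (2 * s) : ℕ) * R) (hR : R ∣ p ^ (2 * s))
    (hR' : R ≤ p ^ (4 * d)) (hdvd : ((p ^ d + 1 : ℕ) : ℤ) ∣ T - 1) :
    T = -(p : ℤ) ^ s ∨ T = (p : ℤ) ^ (s + d) ∨ T = -(p : ℤ) ^ (s + 2 * d) := by
  obtain ⟨e, -, rfl⟩ := (Nat.dvd_prime_pow hp).1 hR
  have he : e ≤ 4 * d := (Nat.pow_le_pow_iff_right hp.one_lt).1 hR'
  have hn : T.natAbs ^ 2 = p ^ (2 * s + e) := by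
    rw [pow_add]
    zify
    rw [sq_abs, hT]
    push_cast
    ring
  obtain ⟨g, -, hg⟩ := (Nat.dvd_prime_pow hp).1 (hn ▸ dvd_pow_self T.natAbs two_ne_zero)
  rw [hg, ← pow_mul] at hn
  have hge := Nat.pow_right_injective hp.two_le hn
  obtain ⟨f, rfl⟩ : ∃ f, g = s + f := ⟨g - s, by omega⟩
  have hf : f ≤ 2 * d := by omega
  obtain ⟨ε, hε, rfl⟩ : ∃ ε : ℤ, (ε = 1 ∨ ε = -1) ∧ T = ε * (p : ℤ) ^ (s + f) := by
    rcases Int.natAbs_eq T with h | h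
    · exact ⟨1, Or.inl rfl, by rw [h, hg]; push_cast; ring⟩
    · exact ⟨-1, Or.inr rfl, by rw [h, hg]; push_cast; ring⟩
  push_cast at hdvd
  have hs1 : ((p : ℤ) ^ d + 1) ∣ (p : ℤ) ^ s + 1 := by
    have := pow_add_one_dvd_pow_add_one p d j
    rw [← hs] at this
    exact_mod_cast Int.natCast_dvd_natCast.2 this
  have h1 : ((p : ℤ) ^ d + 1) ∣ ε * (p : ℤ) ^ f + 1 := by
    have h := dvd_sub (hs1.mul_right (ε * (p : ℤ) ^ f)) hdvd
    have e : ((p : ℤ) ^ s + 1) * (ε * (p : ℤ) ^ f) - (ε * (p : ℤ) ^ (s + f) - 1)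
        = ε * (p : ℤ) ^ f + 1 := by ring
    rwa [e] at h
  have hD : (3 : ℤ) ≤ (p : ℤ) ^ d := by
    calc (3 : ℤ) ≤ p := by exact_mod_cast hp3
      _ ≤ (p : ℤ) ^ d := le_self_pow₀ (by exact_mod_cast hp.one_le) hd.ne'
  rcases lt_or_ge f d with hfd | hfd
  · obtain ⟨rfl, rfl⟩ := eq_of_dvd_of_pow_lt hp3 hfd hε h1
    left
    simp
  · obtain ⟨i, rfl⟩ := Nat.exists_eq_add_of_le hfd
    have h2 : ((p : ℤ) ^ d + 1) ∣ (-ε) * (p : ℤ) ^ i + 1 := by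
      have h := dvd_sub h1 ((dvd_refl ((p : ℤ) ^ d + 1)).mul_right (ε * (p : ℤ) ^ i))
      have e : ε * (p : ℤ) ^ (d + i) + 1 - ((p : ℤ) ^ d + 1) * (ε * (p : ℤ) ^ i)
          = (-ε) * (p : ℤ) ^ i + 1 := by ring
      rwa [e] at h
    rcases lt_or_ge i d with hid | hid
    · obtain ⟨rfl, h3⟩ := eq_of_dvd_of_pow_lt hp3 hid (by omega) h2
      right; left
      rw [neg_inj.1 h3]
      simp
    · have hid' : i = d := by omega
      subst hid'
      rcases hε with rfl | rfl
      · have := Int.eq_zero_of_abs_lt_dvd h2 (by rw [abs_lt]; constructor <;> omega)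
        omega
      · right; right
        rw [two_mul]
        simp

end PossibleValues

section FixedPoints

lemma pow_add_one_eq_of_pow_add_one_eq {F : Type*} [Field F] {p d j s : ℕ}
    (hs : s = d + 2 * d * j) {u c : F}
    (hu : u ^ (p ^ d + 1) = c) (hc : c ^ p ^ d = c) : u ^ (p ^ s + 1) = c := by
  by_cases hu0 : u = 0
  · subst hu0
    rw [zero_pow (Nat.succ_ne_zero _)] at hu ⊢
    exact hu
  have h1 : u ^ p ^ (2 * d) = u := by
    have e1 : u ^ p ^ (2 * d) * u ^ p ^ d = u * u ^ p ^ d := by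
      have : (u ^ (p ^ d + 1)) ^ p ^ d = u ^ p ^ (2 * d) * u ^ p ^ d := by
        rw [← pow_mul, ← pow_add]
        ring_nf
      rw [← this, hu, hc, ← hu, pow_succ']
    exact mul_right_cancel₀ (pow_ne_zero _ hu0) e1
  rw [pow_succ, hs, pow_pow_add_mul_eq h1, ← pow_succ, hu]

lemma two_ne_zero_of_odd {p : ℕ} [Fact p.Prime] {F : Type*} [Field F] [Algebra (ZMod p) F]
    (hp : Odd p) : (2 : F) ≠ 0 := by
  have : CharP F p := charP_of_injective_algebraMap (algebraMap (ZMod p) F).injective p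
  refine Ring.two_ne_zero ?_
  rw [ringChar.eq F p]
  rintro rfl
  exact absurd hp (by decide)

lemma algebraMap_pow_prime_pow {p : ℕ} [Fact p.Prime] {F : Type*} [Field F]
    [Algebra (ZMod p) F] (v : ZMod p) (n : ℕ) :
    (algebraMap (ZMod p) F v) ^ p ^ n = algebraMap (ZMod p) F v := by
  rw [← map_pow, ZMod.pow_card_pow]

variable {F : Type*} [Field F] [Fintype F]

lemma pow_prime_pow_card {p m : ℕ} (hF : Fintype.card F = p ^ m) (x : F) : x ^ p ^ m = x := by
  rw [← hF, FiniteField.pow_card]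

lemma pow_sq_sub_one_dvd {F : Type*} [Fintype F] {p m d : ℕ} (hF : Fintype.card F = p ^ m)
    (hdm : 2 * d ∣ m) :
    (p ^ d + 1) * (p ^ d - 1) ∣ Fintype.card F - 1 := by
  rw [hF, ← Nat.sq_sub_sq, one_pow, ← pow_mul, mul_comm d 2]
  exact Nat.pow_sub_one_dvd_pow_sub_one p hdm

lemma exists_pow_add_one_eq {p m d : ℕ} [Fact p.Prime] (hF : Fintype.card F = p ^ m) (hd : 0 < d)
    (hdm : 2 * d ∣ m) {c : F} (hc : c ^ p ^ d = c) : ∃ u : F, u ^ (p ^ d + 1) = c := by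
  by_cases hc0 : c = 0
  · exact ⟨0, by rw [hc0, zero_pow (Nat.succ_ne_zero _)]⟩
  have hpd : 1 < p ^ d := Nat.one_lt_pow hd.ne' (Fact.out : p.Prime).one_lt
  refine exists_pow_eq_of_pow_eq_one (Nat.sub_pos_of_lt hpd) (pow_sq_sub_one_dvd hF hdm) ?_
  refine mul_right_cancel₀ hc0 ?_
  rw [← pow_succ, Nat.sub_add_cancel hpd.le, hc, one_mul]

lemma card_filter_pow_pow_eq_self [DecidableEq F] {p m e : ℕ} (hp : 2 ≤ p)
    (hF : Fintype.card F = p ^ m) (he : e ∣ m) (he0 : 0 < e) :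
    (Finset.univ.filter fun x : F => x ^ p ^ e = x).card = p ^ e := by
  have hpe : 1 < p ^ e := Nat.one_lt_pow he0.ne' (by omega)
  have hn : p ^ e - 1 ∣ Fintype.card F - 1 := hF ▸ Nat.pow_sub_one_dvd_pow_sub_one p he
  have h1 := card_filter_pow_eq_pow hn (one_ne_zero (α := F))
  have h2 : (Finset.univ.filter fun x : F => x ^ p ^ e = x)
      = insert 0 (Finset.univ.filter fun x : F => x ^ (p ^ e - 1) = 1 ^ (p ^ e - 1)) := by
    ext x
    have hx : x ^ p ^ e = x ^ (p ^ e - 1) * x := by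
      rw [← pow_succ, Nat.sub_add_cancel hpe.le]
    simp only [Finset.mem_filter, Finset.mem_univ, true_and, Finset.mem_insert, one_pow, hx]
    by_cases h0 : x = 0
    · simp [h0]
    · simp [h0]
  rw [h2, Finset.card_insert_of_notMem, h1, Nat.sub_add_cancel hpe.le]
  have hne : p ^ e - 1 ≠ 0 := by omega
  simp [zero_pow hne]

/-- A second order linear difference equation in an endomorphism `τ` has at most `N ^ 2`
solutions, where `N` bounds the number of fixed points of `τ`. -/
lemma card_filter_second_order_le [DecidableEq F] (τ : F →+* F) {N : ℕ}
    (hN : (Finset.univ.filter fun x : F => τ x = x).card ≤ N) {A B C : F} (hB : B ≠ 0) :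
    (Finset.univ.filter fun x : F => B * τ (τ x) + A * τ x + C * x = 0).card ≤ N ^ 2 := by
  have hN1 : 1 ≤ N := by
    refine le_trans (Finset.card_pos.2 ⟨0, ?_⟩) hN
    simp
  by_cases hne : ∃ x₀ : F, x₀ ≠ 0 ∧ B * τ (τ x₀) + A * τ x₀ + C * x₀ = 0
  swap
  · push Not at hne
    refine le_trans (Finset.card_le_one.2 ?_) (one_le_pow₀ hN1)
    intro a ha b hb
    have h0 : ∀ x : F, x ∈ (Finset.univ.filter fun x : F => B * τ (τ x) + A * τ x + C * x = 0) →
        x = 0 := by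
      intro x hx
      by_contra hx0
      exact hne x hx0 (Finset.mem_filter.1 hx).2
    rw [h0 a ha, h0 b hb]
  obtain ⟨x₀, hx₀, hsol⟩ := hne
  have hτ0 : ∀ {x : F}, x ≠ 0 → τ x ≠ 0 := fun hx => (map_ne_zero τ).2 hx
  set S := Finset.univ.filter fun x : F => B * τ (τ x) + A * τ x + C * x = 0 with hS
  let f : F → F := fun x => τ (x / x₀) - x / x₀
  have himage : ∀ w ∈ S.image f, B * τ (τ x₀) * τ w = C * x₀ * w := by
    intro w hw
    obtain ⟨x, hx, rfl⟩ := Finset.mem_image.1 hw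
    have hx' : B * τ (τ x) + A * τ x + C * x = 0 := (Finset.mem_filter.1 hx).2
    obtain ⟨z, rfl⟩ : ∃ z, x = x₀ * z := ⟨x / x₀, by field_simp⟩
    simp only [f, mul_div_cancel_left₀ z hx₀, map_mul, map_sub] at hx' ⊢
    linear_combination hx' - τ z * hsol
  have hcard : (S.image f).card ≤ N := by
    by_cases hw : ∃ w₀ ∈ S.image f, w₀ ≠ 0
    · obtain ⟨w₀, hw₀, hw0⟩ := hw
      refine le_trans (Finset.card_le_card_of_injOn (fun w => w / w₀) ?_ ?_) hN
      · intro w hw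
        have e1 := himage w hw
        have e2 := himage w₀ hw₀
        simp only [Finset.coe_filter, Finset.mem_univ, true_and, Set.mem_ofPred_eq, map_div₀]
        rw [div_eq_div_iff (hτ0 hw0) hw0]
        refine mul_left_cancel₀ (mul_ne_zero hB (hτ0 (hτ0 hx₀))) ?_
        linear_combination w₀ * e1 - w * e2
      · intro a _ b _ hab
        exact (div_left_inj' hw0).1 hab
    · push Not at hw
      refine le_trans (Finset.card_le_one.2 ?_) hN1
      intro a ha b hb
      rw [hw a ha, hw b hb]
  rw [sq]
  refine le_trans (Finset.card_le_mul_card_image (f := f) S N ?_) (Nat.mul_le_mul_left N hcard)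
  intro w hw
  obtain ⟨x₁, hx₁, rfl⟩ := Finset.mem_image.1 hw
  refine le_trans (Finset.card_le_card_of_injOn (fun x => x / x₀ - x₁ / x₀) ?_ ?_) hN
  · intro x hx
    have hx' : τ (x / x₀) - x / x₀ = τ (x₁ / x₀) - x₁ / x₀ :=
      (Finset.mem_filter.1 (Finset.mem_coe.1 hx)).2
    simp only [Finset.coe_filter, Finset.mem_univ, true_and, Set.mem_ofPred_eq, map_sub]
    linear_combination hx'
  · intro a _ b _ hab
    exact (div_left_inj' hx₀).1 (sub_left_injective hab)

end FixedPoints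

section TraceForm

variable {p s l d j k : ℕ} [Fact p.Prime] {F : Type*} [Field F] [Fintype F]
  [Algebra (ZMod p) F]

/-- The `n`-th iterate of the Frobenius map as a linear map over the prime field. -/
noncomputable def frobeniusPow (p : ℕ) [Fact p.Prime] (F : Type*) [Field F] [Fintype F]
    [Algebra (ZMod p) F] (n : ℕ) : F ≃ₐ[ZMod p] F :=
  FiniteField.frobeniusAlgEquivOfAlgebraic (ZMod p) F ^ n

lemma frobeniusPow_apply (n : ℕ) (x : F) : frobeniusPow p F n x = x ^ p ^ n := by
  rw [frobeniusPow, AlgEquiv.coe_pow, FiniteField.coe_frobeniusAlgEquivOfAlgebraic_iterate,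
    ZMod.card]

lemma add_pow_prime_pow (p : ℕ) [Fact p.Prime] [Algebra (ZMod p) F] (n : ℕ) (x y : F) :
    (x + y) ^ p ^ n = x ^ p ^ n + y ^ p ^ n := by
  simp_rw [← frobeniusPow_apply (p := p), map_add]

lemma sub_pow_prime_pow (p : ℕ) [Fact p.Prime] [Algebra (ZMod p) F] (n : ℕ) (x y : F) :
    (x - y) ^ p ^ n = x ^ p ^ n - y ^ p ^ n := by
  simp_rw [← frobeniusPow_apply (p := p), map_sub]

lemma trace_pow_prime_pow (n : ℕ) (x : F) :
    Algebra.trace (ZMod p) F (x ^ p ^ n) = Algebra.trace (ZMod p) F x := by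
  rw [← frobeniusPow_apply, Algebra.trace_eq_of_algEquiv]

/-- The quadratic function `x ↦ Tr (a x^(p^s+1) / 2 + b x^(p^l+1))`. -/
noncomputable def quadForm (p s l : ℕ) [Fact p.Prime] {F : Type*} [Field F]
    [Algebra (ZMod p) F] (a b x : F) : ZMod p :=
  Algebra.trace (ZMod p) F (2⁻¹ * a * x ^ (p ^ s + 1) + b * x ^ (p ^ l + 1))

/-- The linear map whose associated trace form is the polar form of `quadForm p s l a b`. -/
noncomputable def polarMap (p s l : ℕ) [Fact p.Prime] {F : Type*} [Field F] [Fintype F]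
    [Algebra (ZMod p) F] (a b : F) : F →ₗ[ZMod p] F :=
  LinearMap.mulLeft (ZMod p) a ∘ₗ (frobeniusPow p F s).toLinearMap
    + LinearMap.mulLeft (ZMod p) b ∘ₗ (frobeniusPow p F l).toLinearMap
    + (frobeniusPow p F (2 * s - l)).toLinearMap ∘ₗ LinearMap.mulLeft (ZMod p) b

lemma polarMap_apply {s l : ℕ} (a b y : F) :
    polarMap p s l a b y = a * y ^ p ^ s + b * y ^ p ^ l + (b * y) ^ p ^ (2 * s - l) := by
  simp [polarMap, frobeniusPow_apply]

lemma quadForm_levelCard_eq (hF : Fintype.card F = p ^ (2 * s)) (hd : 0 < d)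
    (hs : s = d + 2 * d * j) (hl : l = d + 2 * d * k) (a b : F) {v : ZMod p} (hv : v ≠ 0) :
    levelCard (quadForm p s l a b) v = levelCard (quadForm p s l a b) 1 := by
  obtain ⟨u, hu⟩ := exists_pow_add_one_eq hF hd ⟨1 + 2 * j, by rw [hs]; ring⟩
    (algebraMap_pow_prime_pow (F := F) v d)
  have hu0 : u ≠ 0 := by
    rintro rfl
    rw [zero_pow (Nat.succ_ne_zero _)] at hu
    exact hv ((map_eq_zero _).1 hu.symm)
  rw [← levelCard_comp_equiv _ (Equiv.mulLeft₀ u hu0) v]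
  refine congrArg Finset.card (Finset.filter_congr fun x _ => ?_)
  have h1 : quadForm p s l a b (u * x) = v * quadForm p s l a b x := by
    rw [quadForm, mul_pow, mul_pow,
      pow_add_one_eq_of_pow_add_one_eq hs hu (algebraMap_pow_prime_pow v d),
      pow_add_one_eq_of_pow_add_one_eq hl hu (algebraMap_pow_prime_pow v d), quadForm,
      ← smul_eq_mul v, ← map_smul, Algebra.smul_def]
    congr 1
    ring
  change quadForm p s l a b (u * x) = v ↔ _
  rw [h1, mul_eq_left₀ hv]

lemma isQuadWith_quadForm (hp : Odd p) (hF : Fintype.card F = p ^ (2 * s)) (hd : 0 < d)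
    (hs : s = d + 2 * d * j) (hl : l = d + 2 * d * k) (hls : l ≤ 2 * s) {a : F}
    (ha : a ^ p ^ s = a) (b : F) :
    IsQuadWith (quadForm p s l a b) (polarMap p s l a b) where
  map_add x y := by
    have h2 : (2 : F) ≠ 0 := two_ne_zero_of_odd (p := p) hp
    have e1 : Algebra.trace (ZMod p) F (2⁻¹ * a * (x ^ p ^ s * y))
        = Algebra.trace (ZMod p) F (2⁻¹ * a * (x * y ^ p ^ s)) := by
      rw [← trace_pow_prime_pow s]
      congr 1
      have : (2⁻¹ : F) ^ p ^ s = 2⁻¹ := by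
        have := algebraMap_pow_prime_pow (F := F) (2⁻¹ : ZMod p) s
        rwa [map_inv₀, map_ofNat] at this
      rw [mul_pow, mul_pow, mul_pow, ha, this, ← pow_mul, ← pow_add, ← two_mul,
        pow_prime_pow_card hF]
    have e2 : Algebra.trace (ZMod p) F (b * (x ^ p ^ l * y))
        = Algebra.trace (ZMod p) F (x * (b * y) ^ p ^ (2 * s - l)) := by
      rw [← trace_pow_prime_pow l (x * (b * y) ^ p ^ (2 * s - l)), mul_pow, ← pow_mul, ← pow_add,
        Nat.sub_add_cancel hls, pow_prime_pow_card hF]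
      congr 1
      ring
    have e3 : 2⁻¹ * a * (x + y) ^ (p ^ s + 1) + b * (x + y) ^ (p ^ l + 1)
        = (2⁻¹ * a * x ^ (p ^ s + 1) + b * x ^ (p ^ l + 1))
          + (2⁻¹ * a * y ^ (p ^ s + 1) + b * y ^ (p ^ l + 1))
          + (2⁻¹ * a * (x ^ p ^ s * y) + 2⁻¹ * a * (x * y ^ p ^ s) + b * (x * y ^ p ^ l)
            + b * (x ^ p ^ l * y)) := by
      rw [pow_succ (x + y), pow_succ (x + y), add_pow_prime_pow p, add_pow_prime_pow p]
      ring
    have e4 : x * polarMap p s l a b y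
        = 2⁻¹ * a * (x * y ^ p ^ s) + 2⁻¹ * a * (x * y ^ p ^ s) + b * (x * y ^ p ^ l)
          + x * (b * y) ^ p ^ (2 * s - l) := by
      rw [polarMap_apply, ← add_mul, ← add_mul, ← two_mul, mul_inv_cancel₀ h2]
      ring
    rw [e4, quadForm, e3]
    simp only [map_add, e1, e2, quadForm]
  map_neg x := by
    have hpo : Odd p := hp
    rw [quadForm, Even.neg_pow (hpo.pow.add_one), Even.neg_pow (hpo.pow.add_one), quadForm]
  levelCard_eq v hv := quadForm_levelCard_eq hF hd hs hl a b hv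

lemma card_ker_polarMap_le (hF : Fintype.card F = p ^ (2 * s)) (hd : 0 < d)
    (hds : d ∣ s) (hd' : Nat.gcd (s + l) (2 * l) = 2 * d) (hls : l ≤ 2 * s) {a b : F}
    (hab : a ≠ 0 ∨ b ≠ 0) : Nat.card (LinearMap.ker (polarMap p s l a b)) ≤ p ^ (4 * d) := by
  classical
  have hcard : Nat.card (LinearMap.ker (polarMap p s l a b))
      = (Finset.univ.filter fun y : F => polarMap p s l a b y = 0).card :=
    Nat.subtype_card _ (by simp)
  rw [hcard]
  have hpp := (Fact.out : p.Prime)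
  by_cases hb : b = 0
  · refine le_trans (Finset.card_le_one.2 ?_) (Nat.one_le_pow _ _ hpp.pos)
    have ha := hab.resolve_right (not_not.2 hb)
    have h0 : ∀ y ∈ Finset.univ.filter fun y : F => polarMap p s l a b y = 0, y = 0 := by
      intro y hy
      have := (Finset.mem_filter.1 hy).2
      rw [polarMap_apply, hb, zero_mul, zero_mul, zero_pow (pow_pos hpp.pos _).ne', add_zero,
        add_zero, mul_eq_zero] at this
      exact eq_zero_of_pow_eq_zero (this.resolve_left ha)
    intro x hx y hy
    rw [h0 x hx, h0 y hy]
  · let τ : F →+* F := (frobeniusPow p F (s + l) : F →ₐ[ZMod p] F)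
    have hτ : ∀ x, τ x = x ^ p ^ (s + l) := fun x => frobeniusPow_apply (p := p) (s + l) x
    have hττ : ∀ x : F, (x ^ p ^ (s + l)) ^ p ^ (s + l) = x ^ p ^ (2 * l) := by
      intro x
      rw [← pow_mul, ← pow_add, show s + l + (s + l) = 2 * s + 2 * l by ring, pow_add, pow_mul,
        pow_prime_pow_card hF]
    have hN : (Finset.univ.filter fun x : F => τ x = x).card ≤ p ^ (2 * d) := by
      rw [← card_filter_pow_pow_eq_self hpp.two_le hF (Nat.mul_dvd_mul_left 2 hds) (by omega)]
      refine Finset.card_le_card fun x hx => ?_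
      have hx1 : x ^ p ^ (s + l) = x := (hτ x).symm.trans (Finset.mem_filter.1 hx).2
      have hx2 : x ^ p ^ (2 * l) = x := by rw [← hττ, hx1, hx1]
      refine Finset.mem_filter.2 ⟨Finset.mem_univ _, ?_⟩
      rw [← hd']
      exact pow_pow_gcd_eq_self hx1 hx2
    have h1 := card_filter_second_order_le τ hN (A := a ^ p ^ l)
      (C := b) (pow_ne_zero (p ^ l) hb)
    rw [show 4 * d = 2 * d * 2 by ring, pow_mul]
    refine le_trans (Finset.card_le_card fun x hx => ?_) h1
    have hx' := (Finset.mem_filter.1 hx).2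
    refine Finset.mem_filter.2 ⟨Finset.mem_univ _, ?_⟩
    rw [polarMap_apply] at hx'
    have h2 := congrArg (· ^ p ^ l) hx'
    simp only [add_pow_prime_pow p] at h2
    rw [← pow_mul (b * x), ← pow_add, Nat.sub_add_cancel hls, pow_prime_pow_card hF, mul_pow,
      mul_pow, ← pow_mul x, ← pow_mul x, ← pow_add, ← pow_add, ← two_mul,
      zero_pow (pow_pos hpp.pos _).ne'] at h2
    rw [hτ, hτ, hττ]
    linear_combination h2

lemma levelDiff_quadForm_cases (hp : Odd p) (hF : Fintype.card F = p ^ (2 * s)) (hd : 0 < d)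
    (hs : s = d + 2 * d * j) (hl : l = d + 2 * d * k)
    (hd' : Nat.gcd (s + l) (2 * l) = 2 * d) (hls : l ≤ 2 * s) {a b : F}
    (ha : a ^ p ^ s = a) (hab : a ≠ 0 ∨ b ≠ 0) :
    levelDiff (quadForm p s l a b) = -(p : ℤ) ^ s ∨
      levelDiff (quadForm p s l a b) = (p : ℤ) ^ (s + d) ∨
      levelDiff (quadForm p s l a b) = -(p : ℤ) ^ (s + 2 * d) := by
  classical
  have hpp := (Fact.out : p.Prime)
  have hq := isQuadWith_quadForm hp hF hd hs hl hls ha b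
  have hsq := hq.levelDiff_sq hp
  rw [hF] at hsq
  have hp3 : 3 ≤ p := by
    have := hpp.two_le
    rcases hp with ⟨i, hi⟩
    omega
  have hR : Nat.card (LinearMap.ker (polarMap p s l a b)) ∣ p ^ (2 * s) := by
    rw [← hF, ← Nat.card_eq_fintype_card]
    exact AddSubgroup.card_addSubgroup_dvd_card (LinearMap.ker (polarMap p s l a b)).toAddSubgroup
  have hds : d ∣ s := ⟨1 + 2 * j, by rw [hs]; ring⟩
  refine value_cases hpp hp3 hd hs hsq hR (card_ker_polarMap_le hF hd hds hd' hls hab)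
    (dvd_levelDiff_sub_one ?_ ?_ hq.map_zero)
  · exact dvd_trans (dvd_mul_right _ _) (pow_sq_sub_one_dvd hF (Nat.mul_dvd_mul_left 2 hds))
  · intro x y hxy
    obtain ⟨e1, he1⟩ : p ^ d + 1 ∣ p ^ s + 1 := hs ▸ pow_add_one_dvd_pow_add_one p d j
    obtain ⟨e2, he2⟩ : p ^ d + 1 ∣ p ^ l + 1 := hl ▸ pow_add_one_dvd_pow_add_one p d k
    simp only [quadForm, he1, he2, pow_mul, hxy]

end TraceForm

/-- The elements of the subfield of order `p ^ s`. -/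
def fixedPow (p s : ℕ) (F : Type*) [Field F] [Fintype F] [DecidableEq F] : Finset F :=
  Finset.univ.filter fun a => a ^ p ^ s = a

lemma mem_fixedPow {p s : ℕ} {F : Type*} [Field F] [Fintype F] [DecidableEq F] {a : F} :
    a ∈ fixedPow p s F ↔ a ^ p ^ s = a := by
  simp [fixedPow]

lemma exists_pow_prime_pow_eq_self_trace_ne_zero {p s : ℕ} [Fact p.Prime] {F : Type*} [Field F] [Fintype F]
    [Algebra (ZMod p) F] (hp : Odd p)
    (hF : Fintype.card F = p ^ (2 * s))
    {w : F} (hw : w ^ p ^ s = w) (hw0 : w ≠ 0) :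
    ∃ a : F, a ^ p ^ s = a ∧ Algebra.trace (ZMod p) F (a * w) ≠ 0 := by
  obtain ⟨z, hz⟩ := exists_trace_mul_ne_zero (p := p) hw0
  refine ⟨z + z ^ p ^ s, ?_, ?_⟩
  · rw [add_pow_prime_pow p, ← pow_mul, ← pow_add, ← two_mul, pow_prime_pow_card hF, add_comm]
  · have h1 : Algebra.trace (ZMod p) F (z ^ p ^ s * w) = Algebra.trace (ZMod p) F (z * w) := by
      rw [← trace_pow_prime_pow s (z * w), mul_pow, hw]
    rw [add_mul, map_add, h1, ← two_mul]
    have : (2 : ZMod p) ≠ 0 := two_ne_zero_of_odd (p := p) hp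
    exact mul_ne_zero this hz

lemma addChar_quadForm {p s l : ℕ} [Fact p.Prime] {F : Type*} [Field F]
    [Algebra (ZMod p) F] (χ : AddChar (ZMod p) ℂ) (a b x : F) :
    χ (quadForm p s l a b x) = χ (Algebra.trace (ZMod p) F (a * (2⁻¹ * x ^ (p ^ s + 1))))
      * χ (Algebra.trace (ZMod p) F (b * x ^ (p ^ l + 1))) := by
  have h : 2⁻¹ * a * x ^ (p ^ s + 1) = a * (2⁻¹ * x ^ (p ^ s + 1)) := by ring
  rw [quadForm, map_add, AddChar.map_add_eq_mul, h]

lemma pow_succ_neg_one_iff {p s l d j k : ℕ} {F : Type*} [Field F] [Fintype F]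
    (hF : Fintype.card F = p ^ (2 * s)) (hp : Odd p)
    (hs : s = d + 2 * d * j) (hl : l = d + 2 * d * k) (hd : Nat.gcd s l = d) {t : F} :
    (t ^ (p ^ s + 1) = -1 ∧ t ^ (p ^ l + 1) = -1) ↔ t ^ (p ^ d + 1) = -1 := by
  have hneg : ∀ n, (-1 : F) ^ p ^ n = -1 := fun n => (hp.pow).neg_one_pow
  constructor
  · rintro ⟨h1, h2⟩
    have ht : t ≠ 0 := by
      rintro rfl
      rw [zero_pow (Nat.succ_ne_zero _)] at h1
      exact neg_ne_zero.2 one_ne_zero h1.symm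
    have h3 : t ^ p ^ (2 * s) = t := pow_prime_pow_card hF t
    have h4 : t ^ p ^ (2 * l) = t := by
      have h5 : t ^ p ^ (2 * l) * t ^ p ^ l = t * t ^ p ^ l := by
        have h6 : (t ^ (p ^ l + 1)) ^ p ^ l = t ^ p ^ (2 * l) * t ^ p ^ l := by
          rw [← pow_mul, ← pow_add]
          ring_nf
        rw [← h6, ← pow_succ', h2, hneg]
      exact mul_right_cancel₀ (pow_ne_zero _ ht) h5
    have h7 : t ^ p ^ (2 * d) = t := by
      have := pow_pow_gcd_eq_self h3 h4
      rwa [Nat.gcd_mul_left, hd] at this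
    rw [← h1, pow_succ, pow_succ, hs, pow_pow_add_mul_eq h7]
  · intro h
    exact ⟨pow_add_one_eq_of_pow_add_one_eq hs h (hneg d),
      pow_add_one_eq_of_pow_add_one_eq hl h (hneg d)⟩

lemma quadForm_zero_zero {p s l : ℕ} [Fact p.Prime] {F : Type*} [Field F]
    [Algebra (ZMod p) F] : quadForm p s l (0 : F) 0 = fun _ => 0 := by
  ext x
  simp [quadForm]

lemma levelDiff_zero {p : ℕ} [Fact p.Prime] {F : Type*} [Fintype F] :
    levelDiff (fun _ : F => (0 : ZMod p)) = Fintype.card F := by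
  simp [levelDiff, levelCard]

section Moments

variable {p s l d j k : ℕ} [Fact p.Prime] {F : Type*} [Field F] [Fintype F] [DecidableEq F]
  [Algebra (ZMod p) F]

lemma sum_fixedPow_addChar (hp : Odd p) (hs : 0 < s) (hF : Fintype.card F = p ^ (2 * s))
    {χ : AddChar (ZMod p) ℂ} (hχ : χ ≠ 1) {w : F} (hw : w ^ p ^ s = w) :
    ∑ a ∈ fixedPow p s F, χ (Algebra.trace (ZMod p) F (a * w))
      = if w = 0 then (p : ℂ) ^ s else 0 := by
  split_ifs with hw0
  · simp only [hw0, mul_zero, map_zero, AddChar.map_zero_eq_one, Finset.sum_const, nsmul_eq_mul,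
      mul_one]
    rw [fixedPow, card_filter_pow_pow_eq_self (Fact.out : p.Prime).two_le hF (dvd_mul_left s 2) hs]
    push_cast
    rfl
  · obtain ⟨a₀, ha₀, htr⟩ := exists_pow_prime_pow_eq_self_trace_ne_zero hp hF hw hw0
    obtain ⟨t, ht⟩ := exists_addChar_ne_one hχ htr
    set b := algebraMap (ZMod p) F t * a₀ with hb
    have hb1 : b ^ p ^ s = b := by rw [hb, mul_pow, ha₀, algebraMap_pow_prime_pow]
    have hb2 : χ (Algebra.trace (ZMod p) F (b * w)) ≠ 1 := by
      rwa [hb, mul_assoc, ← Algebra.smul_def, map_smul, smul_eq_mul]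
    have hshift : ∑ a ∈ fixedPow p s F, χ (Algebra.trace (ZMod p) F (a * w))
        = ∑ a ∈ fixedPow p s F, χ (Algebra.trace (ZMod p) F ((a + b) * w)) := by
      symm
      refine Finset.sum_bij (fun a _ => a + b) ?_ ?_ ?_ (fun _ _ => rfl)
      · intro a ha
        rw [mem_fixedPow] at ha ⊢
        rw [add_pow_prime_pow p, ha, hb1]
      · intro a _ a' _ h
        exact add_right_cancel h
      · intro a ha
        refine ⟨a - b, ?_, sub_add_cancel a b⟩
        rw [mem_fixedPow] at ha ⊢
        rw [sub_pow_prime_pow p, ha, hb1]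
    simp_rw [add_mul, map_add, AddChar.map_add_eq_mul, ← Finset.sum_mul] at hshift
    by_contra hne
    exact hb2 (mul_left_cancel₀ hne (by rw [mul_one]; exact hshift.symm))

lemma exists_addChar_zmod_ne_one (p : ℕ) [Fact p.Prime] : ∃ χ : AddChar (ZMod p) ℂ, χ ≠ 1 :=
  ⟨ZMod.stdAddChar, by simpa using (ZMod.isPrimitive_stdAddChar p) (one_ne_zero)⟩

lemma sum_levelDiff_quadForm (hs0 : 0 < s) (hF : Fintype.card F = p ^ (2 * s)) (hd : 0 < d)
    (hs : s = d + 2 * d * j) (hl : l = d + 2 * d * k) :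
    ∑ a ∈ fixedPow p s F, ∑ b : F, levelDiff (quadForm p s l a b) = (p : ℤ) ^ (3 * s) := by
  obtain ⟨χ, hχ⟩ := exists_addChar_zmod_ne_one p
  have key : ((∑ a ∈ fixedPow p s F, ∑ b : F, levelDiff (quadForm p s l a b) : ℤ) : ℂ)
      = (p : ℂ) ^ (3 * s) := by
    push_cast
    have h1 : ∀ a : F, ∑ b : F, (levelDiff (quadForm p s l a b) : ℂ) = p ^ (2 * s) := by
      intro a
      simp_rw [← sum_addChar_eq_levelDiff
        (fun v hv => quadForm_levelCard_eq hF hd hs hl a _ hv) hχ, addChar_quadForm]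
      rw [Finset.sum_comm]
      simp_rw [← Finset.mul_sum, sum_addChar_trace_mul hχ]
      rw [Finset.sum_eq_single 0]
      · simp [hF]
      · intro x _ hx
        rw [if_neg (pow_ne_zero _ hx), mul_zero]
      · simp
    simp_rw [h1]
    rw [Finset.sum_const, fixedPow,
      card_filter_pow_pow_eq_self (Fact.out : p.Prime).two_le hF (dvd_mul_left s 2) hs0,
      nsmul_eq_mul]
    push_cast
    rw [← pow_add]
    congr 1
    ring
  exact_mod_cast key

lemma sum_sq_levelDiff_quadForm (hp : Odd p) (hs0 : 0 < s) (hF : Fintype.card F = p ^ (2 * s))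
    (hd0 : 0 < d) (hs : s = d + 2 * d * j) (hl : l = d + 2 * d * k) (hd : Nat.gcd s l = d) :
    ∑ a ∈ fixedPow p s F, ∑ b : F, levelDiff (quadForm p s l a b) ^ 2
      = (p : ℤ) ^ (3 * s) * (1 + ((p : ℤ) ^ (2 * s) - 1) * ((p : ℤ) ^ d + 1)) := by
  obtain ⟨χ, hχ⟩ := exists_addChar_zmod_ne_one p
  have h2 : (2 : F) ≠ 0 := two_ne_zero_of_odd (p := p) hp
  have hpp := (Fact.out : p.Prime)
  have hcount : ∀ y : F, (Finset.univ.filter fun x : F =>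
      x ^ (p ^ l + 1) + y ^ (p ^ l + 1) = 0 ∧ x ^ (p ^ s + 1) + y ^ (p ^ s + 1) = 0).card
        = if y = 0 then 1 else p ^ d + 1 := by
    intro y
    split_ifs with hy
    · rw [Finset.card_eq_one]
      refine ⟨0, ?_⟩
      ext x
      simp [hy]
    · obtain ⟨u, hu⟩ := exists_pow_add_one_eq hF hd0 ⟨1 + 2 * j, by rw [hs]; ring⟩
        ((hp.pow).neg_one_pow : (-1 : F) ^ p ^ d = -1)
      have hu0 : u ≠ 0 := by
        rintro rfl
        rw [zero_pow (Nat.succ_ne_zero _)] at hu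
        exact neg_ne_zero.2 one_ne_zero hu.symm
      have hn : p ^ d + 1 ∣ Fintype.card F - 1 := dvd_trans (dvd_mul_right _ _)
        (pow_sq_sub_one_dvd (p := p) (m := 2 * s) hF ⟨1 + 2 * j, by rw [hs]; ring⟩)
      rw [← card_filter_pow_eq_pow hn (mul_ne_zero hu0 hy)]
      refine congrArg Finset.card (Finset.filter_congr fun x _ => ?_)
      obtain ⟨t, rfl⟩ : ∃ t, x = t * y := ⟨x / y, (div_mul_cancel₀ x hy).symm⟩
      have e : ∀ n : ℕ, (t * y) ^ n + y ^ n = 0 ↔ t ^ n = -1 := by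
        intro n
        rw [mul_pow, ← add_one_mul, mul_eq_zero, or_iff_left (pow_ne_zero n hy),
          add_eq_zero_iff_eq_neg]
      rw [e, e, and_comm, pow_succ_neg_one_iff hF hp hs hl hd, mul_pow t, mul_pow u, hu,
        mul_left_inj' (pow_ne_zero _ hy)]
  have hcard : (fixedPow p s F).card = p ^ s :=
    card_filter_pow_pow_eq_self hpp.two_le hF (dvd_mul_left s 2) hs0
  have key : ((∑ a ∈ fixedPow p s F, ∑ b : F, levelDiff (quadForm p s l a b) ^ 2 : ℤ) : ℂ)
      = (p : ℂ) ^ (3 * s) * (1 + ((p : ℂ) ^ (2 * s) - 1) * ((p : ℂ) ^ d + 1)) := by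
    push_cast
    have h1 : ∀ a b : F, (levelDiff (quadForm p s l a b) : ℂ) ^ 2
        = ∑ y : F, ∑ x : F,
          χ (Algebra.trace (ZMod p) F (a * (2⁻¹ * (x ^ (p ^ s + 1) + y ^ (p ^ s + 1)))))
            * χ (Algebra.trace (ZMod p) F (b * (x ^ (p ^ l + 1) + y ^ (p ^ l + 1)))) := by
      intro a b
      rw [← sum_addChar_eq_levelDiff
        (fun v hv => quadForm_levelCard_eq hF hd0 hs hl a b hv) hχ, sq, Finset.sum_mul_sum,
        Finset.sum_comm]
      refine Finset.sum_congr rfl fun y _ => Finset.sum_congr rfl fun x _ => ?_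
      rw [addChar_quadForm, addChar_quadForm]
      simp only [mul_add, map_add, AddChar.map_add_eq_mul]
      ring
    have h3 : ∀ x y : F, ∑ a ∈ fixedPow p s F, ∑ b : F,
        χ (Algebra.trace (ZMod p) F (a * (2⁻¹ * (x ^ (p ^ s + 1) + y ^ (p ^ s + 1)))))
            * χ (Algebra.trace (ZMod p) F (b * (x ^ (p ^ l + 1) + y ^ (p ^ l + 1))))
        = if x ^ (p ^ l + 1) + y ^ (p ^ l + 1) = 0 ∧ x ^ (p ^ s + 1) + y ^ (p ^ s + 1) = 0
          then (p : ℂ) ^ (3 * s) else 0 := by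
      intro x y
      simp_rw [← Finset.mul_sum, sum_addChar_trace_mul hχ, ← Finset.sum_mul]
      rw [sum_fixedPow_addChar hp hs0 hF hχ]
      · have e : (2⁻¹ * (x ^ (p ^ s + 1) + y ^ (p ^ s + 1)) = 0)
            ↔ (x ^ (p ^ s + 1) + y ^ (p ^ s + 1) = 0) := by
          rw [mul_eq_zero, or_iff_right (inv_ne_zero h2)]
        simp only [e]
        split_ifs with e1 e2 e3 e4 e5 <;> simp_all
        rw [← pow_add]
        congr 1
        ring
      · have e2 : (2⁻¹ : F) ^ p ^ s = 2⁻¹ := by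
          have := algebraMap_pow_prime_pow (F := F) (2⁻¹ : ZMod p) s
          rwa [map_inv₀, map_ofNat] at this
        have e3 : ∀ z : F, (z ^ (p ^ s + 1)) ^ p ^ s = z ^ (p ^ s + 1) := by
          intro z
          rw [pow_succ, mul_pow, ← pow_mul, ← pow_add p, ← two_mul, pow_prime_pow_card hF, mul_comm]
        rw [mul_pow, add_pow_prime_pow p, e2, e3, e3]
    simp_rw [h1]
    have h4 : ∑ a ∈ fixedPow p s F, ∑ b : F, ∑ y : F, ∑ x : F,
          χ (Algebra.trace (ZMod p) F (a * (2⁻¹ * (x ^ (p ^ s + 1) + y ^ (p ^ s + 1)))))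
            * χ (Algebra.trace (ZMod p) F (b * (x ^ (p ^ l + 1) + y ^ (p ^ l + 1))))
        = ∑ y : F, ∑ x : F, ∑ a ∈ fixedPow p s F, ∑ b : F,
          χ (Algebra.trace (ZMod p) F (a * (2⁻¹ * (x ^ (p ^ s + 1) + y ^ (p ^ s + 1)))))
            * χ (Algebra.trace (ZMod p) F (b * (x ^ (p ^ l + 1) + y ^ (p ^ l + 1)))) := by
      rw [Finset.sum_congr rfl (fun a _ => Finset.sum_comm), Finset.sum_comm]
      refine Finset.sum_congr rfl fun y _ => ?_
      rw [Finset.sum_congr rfl (fun a _ => Finset.sum_comm)]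
      exact Finset.sum_comm
    rw [h4]
    simp_rw [h3, ← Finset.sum_filter, Finset.sum_const, hcount, nsmul_eq_mul, ← Finset.sum_mul]
    rw [mul_comm, ← Finset.add_sum_erase _ _ (Finset.mem_univ (0 : F)),
      Finset.sum_congr rfl (g := fun _ => ((p ^ d + 1 : ℕ) : ℂ))]
    · have : 1 ≤ p ^ (2 * s) := Nat.one_le_pow _ _ hpp.pos
      simp [Finset.card_erase_of_mem, hF, Nat.cast_sub this]
      exact Or.inl (by ring)
    · intro y hy
      rw [if_neg (Finset.ne_of_mem_erase hy)]
  exact_mod_cast key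

/-- The number of pairs `(a, b)` for which `quadForm p s l a b` is nondegenerate. -/
lemma card_levelDiff_eq (hp : Odd p) (hs0 : 0 < s) (hF : Fintype.card F = p ^ (2 * s))
    (hd0 : 0 < d) (hs : s = d + 2 * d * j) (hl : l = d + 2 * d * k) (hd : Nat.gcd s l = d)
    (hd' : Nat.gcd (s + l) (2 * l) = 2 * d) (hls : l ≤ 2 * s) :
    (((fixedPow p s F ×ˢ (Finset.univ : Finset F)).filter fun t =>
      levelDiff (quadForm p s l t.1 t.2) = -(p : ℤ) ^ s).card : ℤ)
        * (((p : ℤ) ^ d + 1) * ((p : ℤ) ^ (2 * d) - 1))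
      = ((p : ℤ) ^ s - 1) * ((p : ℤ) ^ (3 * d) * ((p : ℤ) ^ (2 * s) + (p : ℤ) ^ s + 1)
        - (p : ℤ) ^ s * ((p : ℤ) ^ s * ((p : ℤ) ^ d + 1) + (p : ℤ) ^ (2 * d))) := by
  have hpp := (Fact.out : p.Prime)
  have hp1 : (1 : ℤ) < p := by exact_mod_cast hpp.one_lt
  have m1 := sum_levelDiff_quadForm hs0 hF hd0 hs hl
  have m2 := sum_sq_levelDiff_quadForm hp hs0 hF hd0 hs hl hd
  rw [← Finset.sum_product'] at m1 m2
  have hcardK : (fixedPow p s F).card = p ^ s :=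
    card_filter_pow_pow_eq_self hpp.two_le hF (dvd_mul_left s 2) hs0
  set U := fixedPow p s F ×ˢ (Finset.univ : Finset F) with hU
  set T : F × F → ℤ := fun t => levelDiff (quadForm p s l t.1 t.2) with hT
  have hcardU : (U.card : ℤ) = p ^ (3 * s) := by
    rw [hU, Finset.card_product, hcardK, Finset.card_univ, hF, ← pow_add]
    push_cast
    congr 1
    ring
  have hmem0 : ((0, 0) : F × F) ∈ U := by
    rw [hU, Finset.mem_product, mem_fixedPow]
    exact ⟨zero_pow (pow_pos hpp.pos _).ne', Finset.mem_univ _⟩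
  have hT0 : T (0, 0) = (p : ℤ) ^ (2 * s) := by
    rw [hT]
    dsimp only
    rw [quadForm_zero_zero, levelDiff_zero, hF]
    push_cast
    rfl
  have hsum : ∑ t ∈ U, (T t - (p : ℤ) ^ (s + d)) * (T t + (p : ℤ) ^ (s + 2 * d))
      = ((p : ℤ) ^ (2 * s) - (p : ℤ) ^ (s + d)) * ((p : ℤ) ^ (2 * s) + (p : ℤ) ^ (s + 2 * d))
        + (U.filter fun t => T t = -(p : ℤ) ^ s).card *
          ((-(p : ℤ) ^ s - (p : ℤ) ^ (s + d)) * (-(p : ℤ) ^ s + (p : ℤ) ^ (s + 2 * d))) := by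
    rw [← Finset.add_sum_erase _ _ hmem0, hT0, add_right_inj]
    have hfil : (U.filter fun t => T t = -(p : ℤ) ^ s)
        = (U.erase (0, 0)).filter fun t => T t = -(p : ℤ) ^ s := by
      ext t
      simp only [Finset.mem_filter, Finset.mem_erase]
      refine ⟨fun ⟨h1, h2⟩ => ⟨⟨?_, h1⟩, h2⟩, fun ⟨⟨_, h1⟩, h2⟩ => ⟨h1, h2⟩⟩
      rintro rfl
      rw [hT0] at h2
      have e1 : (0 : ℤ) < (p : ℤ) ^ (2 * s) := by positivity
      have e2 : (0 : ℤ) < (p : ℤ) ^ s := by positivity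
      omega
    rw [hfil, ← nsmul_eq_mul, ← Finset.sum_const, Finset.sum_filter]
    refine Finset.sum_congr rfl fun t ht => ?_
    obtain ⟨ht0, htU⟩ := Finset.mem_erase.1 ht
    have hab : t.1 ≠ 0 ∨ t.2 ≠ 0 := by
      by_contra! h
      exact ht0 (Prod.ext h.1 h.2)
    have hcases : T t = _ ∨ T t = _ ∨ T t = _ := levelDiff_quadForm_cases hp hF hd0 hs hl hd' hls
      (mem_fixedPow.1 (Finset.mem_product.1 htU).1) hab
    split_ifs with h
    · rw [h]
    · rcases hcases with h1 | h1 | h1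
      · exact absurd h1 h
      · rw [h1, sub_self, zero_mul]
      · rw [h1, neg_add_cancel, mul_zero]
  have hexp : ∑ t ∈ U, (T t - (p : ℤ) ^ (s + d)) * (T t + (p : ℤ) ^ (s + 2 * d))
      = ∑ t ∈ U, T t ^ 2 + ((p : ℤ) ^ (s + 2 * d) - (p : ℤ) ^ (s + d)) * ∑ t ∈ U, T t
        - (p : ℤ) ^ (s + d) * (p : ℤ) ^ (s + 2 * d) * U.card := by
    rw [Finset.mul_sum, ← Finset.sum_add_distrib, mul_comm _ (U.card : ℤ), ← nsmul_eq_mul,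
      ← Finset.sum_const, ← Finset.sum_sub_distrib]
    refine Finset.sum_congr rfl fun t _ => ?_
    ring
  rw [hexp, m1, m2, hcardU] at hsum
  have hP : (p : ℤ) ^ (2 * s) ≠ 0 := by positivity
  refine mul_left_cancel₀ hP ?_
  set N : ℤ := ((U.filter fun t => T t = -(p : ℤ) ^ s).card : ℤ)
  simp only [mul_comm 2 s, mul_comm 3 s, mul_comm 2 d, mul_comm 3 d, pow_add, pow_mul] at hsum ⊢
  linear_combination hsum

end Moments

section Designs

lemma card_filter_pair_mul {X : Type*} [Fintype X] [DecidableEq X] {𝓑 : Finset (Finset X)} {i : ℕ}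
    (hcard : ∀ S ∈ 𝓑, S.card = i)
    (htrans : ∀ x y x' y' : X, x ≠ y → x' ≠ y' → ∃ e : Equiv.Perm X, e x = x' ∧ e y = y' ∧
      ∀ S ∈ 𝓑, (Finset.univ.filter fun z => e z ∈ S) ∈ 𝓑) {x y : X} (hxy : x ≠ y) :
    (𝓑.filter fun S => x ∈ S ∧ y ∈ S).card * (Fintype.card X * (Fintype.card X - 1))
      = 𝓑.card * (i * (i - 1)) := by
  have hle : ∀ x y x' y' : X, x ≠ y → x' ≠ y' →
      (𝓑.filter fun S => x' ∈ S ∧ y' ∈ S).card ≤ (𝓑.filter fun S => x ∈ S ∧ y ∈ S).card := by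
    intro x y x' y' h h'
    obtain ⟨e, rfl, rfl, he⟩ := htrans x y x' y' h h'
    refine Finset.card_le_card_of_injOn (fun S => Finset.univ.filter fun z => e z ∈ S) ?_ ?_
    · intro S hS
      simp only [Finset.coe_filter, Set.mem_ofPred_eq] at hS ⊢
      simpa [hS.2] using he S hS.1
    · intro S _ S' _ h
      ext z
      have := Finset.ext_iff.1 h (e.symm z)
      simpa using this
  have hconst : ∀ t ∈ (Finset.univ : Finset X).offDiag,
      (𝓑.filter fun S => t.1 ∈ S ∧ t.2 ∈ S).card = (𝓑.filter fun S => x ∈ S ∧ y ∈ S).card := by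
    intro t ht
    have ht' := (Finset.mem_offDiag.1 ht).2.2
    exact le_antisymm (hle _ _ _ _ hxy ht') (hle _ _ _ _ ht' hxy)
  have hmul : ∀ n : ℕ, n * (n - 1) = n * n - n := fun n => by rw [Nat.mul_sub, mul_one]
  rw [hmul, hmul, ← Finset.card_univ, ← Finset.offDiag_card, mul_comm, ← smul_eq_mul,
    ← Finset.sum_const, ← Finset.sum_congr rfl hconst]
  simp_rw [Finset.card_filter]
  rw [Finset.sum_comm, ← smul_eq_mul, ← Finset.sum_const]
  refine Finset.sum_congr rfl fun S hS => ?_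
  rw [← Finset.card_filter, ← hcard S hS, ← Finset.offDiag_card]
  congr 1
  ext t
  simp only [Finset.mem_filter, Finset.mem_offDiag, Finset.mem_univ, true_and]
  tauto

end Designs

section Supports

variable {p : ℕ} [Fact p.Prime] {X : Type*} [Fintype X]

lemma exists_card_sub_smul_le {f g : X → ZMod p} (hfg : ∀ x, f x ≠ 0 ↔ g x ≠ 0) :
    ∃ r : (ZMod p)ˣ, (p - 1) * (Finset.univ.filter fun x => g x - r * f x ≠ 0).card
      ≤ (p - 2) * (Finset.univ.filter fun x => f x ≠ 0).card := by
  classical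
  have hp2 := (Fact.out : p.Prime).two_le
  set S := Finset.univ.filter fun x => f x ≠ 0 with hS
  have hcover : S.card = ∑ r : (ZMod p)ˣ, (S.filter fun x => g x = r * f x).card := by
    rw [← Finset.card_biUnion]
    · congr 1
      ext x
      simp only [hS, Finset.mem_filter, Finset.mem_univ, true_and, Finset.mem_biUnion]
      refine ⟨fun hx => ?_, fun ⟨_, h⟩ => h.1⟩
      refine ⟨Units.mk0 (g x / f x) (div_ne_zero ((hfg x).1 hx) hx), hx, ?_⟩
      rw [Units.val_mk0, div_mul_cancel₀ _ hx]
    · intro r _ r' _ hr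
      rw [Function.onFun, Finset.disjoint_left]
      intro x hx hx'
      simp only [hS, Finset.mem_filter, Finset.mem_univ, true_and] at hx hx'
      exact hr (Units.ext (mul_right_cancel₀ hx.1 (hx.2.symm.trans hx'.2)))
  obtain ⟨r, hr⟩ : ∃ r : (ZMod p)ˣ,
      S.card ≤ (p - 1) * (S.filter fun x => g x = r * f x).card := by
    by_contra! h
    have h1 := Finset.sum_lt_sum_of_nonempty (s := (Finset.univ : Finset (ZMod p)ˣ))
      Finset.univ_nonempty (fun r _ => h r)
    rw [← Finset.mul_sum, ← hcover, Finset.sum_const, Finset.card_univ, ZMod.card_units] at h1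
    exact lt_irrefl _ h1
  refine ⟨r, ?_⟩
  have hsplit : (Finset.univ.filter fun x => g x - r * f x ≠ 0).card
      + (S.filter fun x => g x = r * f x).card = S.card := by
    rw [← Finset.card_filter_add_card_filter_not (s := S) (fun x => g x = r * f x), add_comm]
    congr 2
    ext x
    simp only [hS, Finset.mem_filter, Finset.mem_univ, true_and, ne_eq, sub_eq_zero]
    refine ⟨fun h => ⟨fun hx => h ?_, h⟩, fun h => h.2⟩
    rw [hx, mul_zero]
    by_contra hg
    exact (hfg x).2 hg hx
  obtain ⟨n, rfl⟩ : ∃ n, p = n + 2 := ⟨p - 2, by omega⟩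
  simp only [Nat.add_sub_cancel, show n + 2 - 1 = n + 1 by omega] at hr ⊢
  nlinarith

lemma mul_card_image_support {V : Type*} [AddCommGroup V] [Module (ZMod p) V] [DecidableEq V]
    [DecidableEq X]
    (E : V →ₗ[ZMod p] X → ZMod p) {W : Finset V} {i : ℕ} (hi : 0 < i)
    (hW : ∀ t ∈ W, (Finset.univ.filter fun x => E t x ≠ 0).card = i)
    (hsmul : ∀ r : (ZMod p)ˣ, ∀ t ∈ W, (r : ZMod p) • t ∈ W)
    (hmin : ∀ t ∈ W, ∀ t' ∈ W, t ≠ t' →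
      (p - 2) * i < (p - 1) * (Finset.univ.filter fun x => E (t - t') x ≠ 0).card) :
    (p - 1) * (W.image fun t => Finset.univ.filter fun x => E t x ≠ 0).card = W.card := by
  rw [Finset.card_eq_sum_card_image (fun t => Finset.univ.filter fun x => E t x ≠ 0) W, mul_comm,
    ← smul_eq_mul, ← Finset.sum_const]
  refine Finset.sum_congr rfl fun S hS => ?_
  obtain ⟨t, ht, rfl⟩ := Finset.mem_image.1 hS
  have ht0 : t ≠ 0 := by
    rintro rfl
    have := hW 0 ht
    simp only [map_zero, Pi.zero_apply, ne_eq, not_true_eq_false, Finset.filter_false,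
      Finset.card_empty] at this
    omega
  have hfib : W.filter (fun t' => (Finset.univ.filter fun x => E t' x ≠ 0)
      = Finset.univ.filter fun x => E t x ≠ 0)
        = Finset.univ.image fun r : (ZMod p)ˣ => (r : ZMod p) • t := by
    ext t'
    simp only [Finset.mem_filter, Finset.mem_image, Finset.mem_univ, true_and]
    constructor
    · rintro ⟨ht', he⟩
      obtain ⟨r, hr⟩ := exists_card_sub_smul_le (f := E t) (g := E t') fun x => by
        have := Finset.ext_iff.1 he x
        simp only [Finset.mem_filter, Finset.mem_univ, true_and] at this
        exact this.symm
      refine ⟨r, ?_⟩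
      by_contra hne
      have h1 := hmin t' ht' _ (hsmul r t ht) (Ne.symm hne)
      rw [hW t ht] at hr
      simp only [map_sub, map_smul, Pi.sub_apply, Pi.smul_apply, smul_eq_mul] at h1
      exact absurd h1 (not_lt.2 hr)
    · rintro ⟨r, rfl⟩
      refine ⟨hsmul r t ht, ?_⟩
      ext x
      simp
  rw [hfib, Finset.card_image_of_injective, Finset.card_univ, ZMod.card_units]
  intro r r' h
  exact Units.ext (smul_left_injective (ZMod p) ht0 h)

end Supports

/-- The linear map sending the parameters `(a, b, c, h)` to the function
`x ↦ quadForm p s l a b x + Tr (c x) + h`. -/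
noncomputable def codeMap (p s l : ℕ) [Fact p.Prime] (F : Type*) [Field F]
    [Algebra (ZMod p) F] : F × F × F × ZMod p →ₗ[ZMod p] F → ZMod p where
  toFun t x := quadForm p s l t.1 t.2.1 x + Algebra.trace (ZMod p) F (t.2.2.1 * x) + t.2.2.2
  map_add' t t' := by
    ext x
    simp only [quadForm, Prod.fst_add, Prod.snd_add, Pi.add_apply, mul_add, add_mul, map_add]
    ring
  map_smul' r t := by
    ext x
    simp only [quadForm, Prod.smul_fst, Prod.smul_snd, Pi.smul_apply, smul_mul_assoc, mul_smul_comm,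
      ← smul_add, map_smul, RingHom.id_apply]

lemma codeMap_apply {p s l : ℕ} [Fact p.Prime] {F : Type*} [Field F] [Algebra (ZMod p) F]
    (t : F × F × F × ZMod p) (x : F) :
    codeMap p s l F t x
      = quadForm p s l t.1 t.2.1 x + Algebra.trace (ZMod p) F (t.2.2.1 * x) + t.2.2.2 := rfl

section Codewords

variable {p s l d j k : ℕ} [Fact p.Prime] {F : Type*} [Field F] [Fintype F]
  [Algebra (ZMod p) F]

lemma levelCard_codeMap (a b c : F) (h : ZMod p) :
    levelCard (codeMap p s l F (a, b, c, h)) 0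
      = levelCard (fun x => quadForm p s l a b x + Algebra.trace (ZMod p) F (c * x)) (-h) := by
  simp only [levelCard, codeMap_apply, add_eq_zero_iff_eq_neg]

lemma card_support_codeMap (t : F × F × F × ZMod p) :
    (Finset.univ.filter fun x => codeMap p s l F t x ≠ 0).card
      + levelCard (codeMap p s l F t) 0 = Fintype.card F := by
  rw [levelCard, add_comm, Finset.card_filter_add_card_filter_not, Finset.card_univ]

lemma codeMap_comp_affine (hp : Odd p) (hF : Fintype.card F = p ^ (2 * s)) (hd : 0 < d)
    (hs : s = d + 2 * d * j) (hl : l = d + 2 * d * k) (hls : l ≤ 2 * s) {a : F}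
    (ha : a ^ p ^ s = a) (b c : F) (h : ZMod p) (u v : F) :
    ∃ t : F × F × F × ZMod p, t.1 ^ p ^ s = t.1 ∧
      ∀ x, codeMap p s l F t x = codeMap p s l F (a, b, c, h) (u * x + v) := by
  refine ⟨(a * u ^ (p ^ s + 1), b * u ^ (p ^ l + 1), u * polarMap p s l a b v + c * u,
    h + quadForm p s l a b v + Algebra.trace (ZMod p) F (c * v)), ?_, fun x => ?_⟩
  · dsimp only
    rw [mul_pow, ha, pow_succ, mul_pow, ← pow_mul, ← pow_add p, ← two_mul, pow_prime_pow_card hF,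
      mul_comm u]
  · have h1 : quadForm p s l (a * u ^ (p ^ s + 1)) (b * u ^ (p ^ l + 1)) x
        = quadForm p s l a b (u * x) := by
      simp only [quadForm, mul_pow]
      congr 1
      ring
    rw [codeMap_apply, codeMap_apply, (isQuadWith_quadForm hp hF hd hs hl hls ha b).map_add]
    dsimp only
    rw [h1, mul_add, add_mul, map_add, map_add, mul_assoc c u x,
      show u * polarMap p s l a b v * x = u * x * polarMap p s l a b v by ring]
    ring

/-- If `quadForm p s l a b` is nondegenerate of minus type, then for each `c` exactly one
constant term yields the exceptional number of zeros. -/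
lemma exists_mul_levelCard_codeMap (hp : Odd p) (hF : Fintype.card F = p ^ (2 * s)) (hd : 0 < d)
    (hs : s = d + 2 * d * j) (hl : l = d + 2 * d * k) (hls : l ≤ 2 * s) {a b : F}
    (ha : a ^ p ^ s = a) (hT : levelDiff (quadForm p s l a b) = -(p : ℤ) ^ s) (c : F) :
    ∃ w : ZMod p, ∀ h, (p : ℤ) * levelCard (codeMap p s l F (a, b, c, h)) 0
      = (p : ℤ) ^ (2 * s) + (if h = w then (p : ℤ) - 1 else -1) * -(p : ℤ) ^ s := by
  have hq := isQuadWith_quadForm hp hF hd hs hl hls ha b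
  have hker : Nat.card (LinearMap.ker (polarMap p s l a b)) = 1 := by
    have h1 := hq.levelDiff_sq hp
    have h2 : ((p : ℤ) ^ s) ^ 2 ≠ 0 := by
      have := (Fact.out : p.Prime).pos
      positivity
    rw [hT, hF, neg_sq] at h1
    push_cast at h1
    rw [mul_comm 2 s, pow_mul] at h1
    have := mul_left_cancel₀ h2 ((mul_one _).trans h1)
    exact_mod_cast this.symm
  rcases hq.levelCard_add_linear hp c with ⟨⟨r, hr, hcr⟩, _⟩ | ⟨_, w, hw⟩
  · obtain ⟨hsub, _⟩ := Nat.card_eq_one_iff_unique.1 hker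
    have : (⟨r, hr⟩ : LinearMap.ker (polarMap p s l a b)) = 0 := Subsingleton.elim _ _
    have hr0 : r = 0 := congrArg Subtype.val this
    rw [hr0, mul_zero, map_zero] at hcr
    exact absurd rfl hcr
  · refine ⟨w, fun h => ?_⟩
    rw [levelCard_codeMap, hw, mul_levelCard_eq hq.levelCard_eq, hT, hF]
    push_cast
    simp only [neg_add_eq_zero]

/-- The possible numbers of zeros of a nonzero codeword. -/
lemma mul_levelCard_codeMap_cases (hp : Odd p) (hF : Fintype.card F = p ^ (2 * s)) (hd : 0 < d)
    (hs : s = d + 2 * d * j) (hl : l = d + 2 * d * k)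
    (hd' : Nat.gcd (s + l) (2 * l) = 2 * d) (hls : l ≤ 2 * s)
    {a b c : F} {h : ZMod p} (ha : a ^ p ^ s = a) (ht : (a, b, c, h) ≠ 0) :
    (p : ℤ) * levelCard (codeMap p s l F (a, b, c, h)) 0 = (p : ℤ) ^ (2 * s) ∨
    levelCard (codeMap p s l F (a, b, c, h)) 0 = 0 ∨
    ∃ T : ℤ, T = levelDiff (quadForm p s l a b) ∧
      (T = -(p : ℤ) ^ s ∨ T = (p : ℤ) ^ (s + d) ∨ T = -(p : ℤ) ^ (s + 2 * d)) ∧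
      ((p : ℤ) * levelCard (codeMap p s l F (a, b, c, h)) 0 = (p : ℤ) ^ (2 * s) + (p - 1) * T ∨
       (p : ℤ) * levelCard (codeMap p s l F (a, b, c, h)) 0 = (p : ℤ) ^ (2 * s) - T) := by
  have hq := isQuadWith_quadForm hp hF hd hs hl hls ha b
  by_cases hab : a ≠ 0 ∨ b ≠ 0
  · rcases hq.levelCard_add_linear hp c with ⟨_, h1⟩ | ⟨_, w, hw⟩
    · left
      rw [levelCard_codeMap]
      have := h1 (-h)
      rw [hF] at this
      exact_mod_cast this
    · refine Or.inr (Or.inr ⟨_, rfl, levelDiff_quadForm_cases hp hF hd hs hl hd' hls ha hab, ?_⟩)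
      rw [levelCard_codeMap, hw, mul_levelCard_eq hq.levelCard_eq, hF]
      push_cast
      split_ifs
      · exact Or.inl rfl
      · exact Or.inr (by ring)
  · push Not at hab
    obtain ⟨rfl, rfl⟩ := hab
    by_cases hc : c = 0
    · right
      left
      subst hc
      have hh : h ≠ 0 := by
        rintro rfl
        exact ht rfl
      rw [levelCard, Finset.card_eq_zero, Finset.filter_eq_empty_iff]
      intro x _
      simpa [codeMap_apply, quadForm] using hh
    · left
      rcases hq.levelCard_add_linear hp c with ⟨_, h1⟩ | ⟨h2, _⟩
      · rw [levelCard_codeMap]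
        have := h1 (-h)
        rw [hF] at this
        exact_mod_cast this
      · obtain ⟨z, hz⟩ := exists_trace_mul_ne_zero (p := p) hc
        refine absurd (h2 z ?_) (by rwa [mul_comm])
        simp [polarMap_apply, (Fact.out : p.Prime).ne_zero]

end Codewords

section Arithmetic

variable {p s d : ℕ}

lemma levelDiff_eq_of_mul_eq (hp : 3 ≤ p) (hs : 0 < s) (hd : 0 < d) {Z T : ℤ}
    (hZ : (p : ℤ) * Z = (p : ℤ) ^ (2 * s) - (p - 1) * (p : ℤ) ^ s)
    (h : (p : ℤ) * Z = (p : ℤ) ^ (2 * s) ∨ Z = 0 ∨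
      (T = -(p : ℤ) ^ s ∨ T = (p : ℤ) ^ (s + d) ∨ T = -(p : ℤ) ^ (s + 2 * d)) ∧
      ((p : ℤ) * Z = (p : ℤ) ^ (2 * s) + (p - 1) * T ∨ (p : ℤ) * Z = (p : ℤ) ^ (2 * s) - T)) :
    T = -(p : ℤ) ^ s := by
  have hp' : (3 : ℤ) ≤ p := by exact_mod_cast hp
  have hP : (0 : ℤ) < (p : ℤ) ^ s := by positivity
  have hpP : (p : ℤ) ≤ (p : ℤ) ^ s := le_self_pow₀ (by linarith) hs.ne'
  have hpD : (p : ℤ) ≤ (p : ℤ) ^ d := le_self_pow₀ (by linarith) hd.ne'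
  have e2 : (p : ℤ) ^ (2 * s) = (p : ℤ) ^ s * (p : ℤ) ^ s := by rw [two_mul, pow_add]
  have e3 : (p : ℤ) ^ (s + d) = (p : ℤ) ^ s * (p : ℤ) ^ d := pow_add _ _ _
  have e4 : (p : ℤ) ^ (s + 2 * d) = (p : ℤ) ^ s * ((p : ℤ) ^ d * (p : ℤ) ^ d) := by
    rw [pow_add, two_mul, pow_add]
  rw [e3, e4, e2] at h
  rw [e2] at hZ
  generalize (p : ℤ) ^ s = P at *
  generalize (p : ℤ) ^ d = D at *
  rcases h with h | h | ⟨h1, h | h⟩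
  · nlinarith
  · rw [h] at hZ
    nlinarith
  · have : ((p : ℤ) - 1) * (T + P) = 0 := by linarith
    rcases mul_eq_zero.1 this with h' | h' <;> linarith
  · rcases h1 with h1 | h1 | h1
    · exact h1
    · rw [h1] at h
      nlinarith
    · rw [h1] at h
      nlinarith [mul_pos hP hP]

lemma weight_bound (hp : 3 ≤ p) (hd : 0 < d) (hsd : 3 * d ≤ s) {Z T : ℤ}
    (h : (p : ℤ) * Z = (p : ℤ) ^ (2 * s) ∨ Z = 0 ∨
      (T = -(p : ℤ) ^ s ∨ T = (p : ℤ) ^ (s + d) ∨ T = -(p : ℤ) ^ (s + 2 * d)) ∧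
      ((p : ℤ) * Z = (p : ℤ) ^ (2 * s) + (p - 1) * T ∨ (p : ℤ) * Z = (p : ℤ) ^ (2 * s) - T)) :
    ((p : ℤ) - 2) * ((p : ℤ) ^ s * ((p : ℤ) ^ s + 1)) < (p : ℤ) * ((p : ℤ) ^ (2 * s) - Z) := by
  have hp' : (3 : ℤ) ≤ p := by exact_mod_cast hp
  have hP : (0 : ℤ) < (p : ℤ) ^ s := by positivity
  have hpD : (p : ℤ) ≤ (p : ℤ) ^ d := le_self_pow₀ (by linarith) hd.ne'
  have hPD : (p : ℤ) ^ d * ((p : ℤ) ^ d * (p : ℤ) ^ d) ≤ (p : ℤ) ^ s := by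
    rw [← pow_add, ← pow_add]
    exact pow_le_pow_right₀ (by linarith) (by omega)
  have e2 : (p : ℤ) ^ (2 * s) = (p : ℤ) ^ s * (p : ℤ) ^ s := by rw [two_mul, pow_add]
  have e3 : (p : ℤ) ^ (s + d) = (p : ℤ) ^ s * (p : ℤ) ^ d := pow_add _ _ _
  have e4 : (p : ℤ) ^ (s + 2 * d) = (p : ℤ) ^ s * ((p : ℤ) ^ d * (p : ℤ) ^ d) := by
    rw [pow_add, two_mul, pow_add]
  rw [e3, e4, e2] at h
  rw [e2]
  generalize (p : ℤ) ^ s = P at *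
  generalize (p : ℤ) ^ d = D at *
  have k1 : 3 * D ≤ D * D := by nlinarith
  have k2 : p * (D * D) ≤ D * (D * D) := by nlinarith
  have k3 : 3 * (D * D) ≤ P := by nlinarith
  have k4 : (p : ℤ) * D ≤ D * D := by nlinarith
  rcases h with h | h | ⟨h1, h | h⟩
  · nlinarith
  · rw [h]
    nlinarith
  · rcases h1 with h1 | h1 | h1
    · subst h1; nlinarith
    · subst h1
      have : P * ((p - 2) * (P + 1)) < P * ((p - 1) * P - (p - 1) * D) := by
        apply mul_lt_mul_of_pos_left _ hP
        nlinarith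
      nlinarith
    · subst h1
      have : 0 ≤ ((p : ℤ) - 1) * (P * (D * D)) := by
        exact mul_nonneg (by linarith) (mul_nonneg hP.le (mul_self_nonneg D))
      nlinarith
  · rcases h1 with h1 | h1 | h1
    · subst h1; nlinarith
    · subst h1
      have : 0 ≤ P * D := by nlinarith
      nlinarith
    · subst h1
      have : P * ((p - 2) * (P + 1)) < P * ((p - 1) * P - D * D) := by
        apply mul_lt_mul_of_pos_left _ hP
        nlinarith
      nlinarith

end Arithmetic

section WeightCount

variable {p s l d j k : ℕ} [Fact p.Prime] {F : Type*} [Field F] [Fintype F]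
  [Algebra (ZMod p) F]

lemma mul_designWeight (hs0 : 0 < s) : (p : ℤ) * ((p ^ (s - 1) * (p - 1) * (p ^ s + 1) : ℕ) : ℤ)
    = (p - 1) * ((p : ℤ) ^ s * ((p : ℤ) ^ s + 1)) := by
  obtain ⟨n, rfl⟩ : ∃ n, s = n + 1 := ⟨s - 1, by omega⟩
  push_cast [Nat.cast_sub (Fact.out : p.Prime).one_le, Nat.add_sub_cancel]
  ring

lemma card_support_codeMap_eq_iff (hs0 : 0 < s) (hF : Fintype.card F = p ^ (2 * s))
    (t : F × F × F × ZMod p) :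
    (Finset.univ.filter fun x => codeMap p s l F t x ≠ 0).card
        = p ^ (s - 1) * (p - 1) * (p ^ s + 1) ↔
      (p : ℤ) * levelCard (codeMap p s l F t) 0
        = (p : ℤ) ^ (2 * s) - (p - 1) * (p : ℤ) ^ s := by
  have h1 := card_support_codeMap (s := s) (l := l) t
  have h2 := mul_designWeight (p := p) hs0
  have hp0 : (p : ℤ) ≠ 0 := by exact_mod_cast (Fact.out : p.Prime).ne_zero
  rw [hF] at h1
  zify at h1
  rw [← Int.natCast_inj, ← mul_right_inj' hp0, h2]
  have e2 : (p : ℤ) ^ (2 * s) = (p : ℤ) ^ s * (p : ℤ) ^ s := by rw [two_mul, pow_add]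
  rw [e2] at h1 ⊢
  constructor <;> intro h <;> linear_combination p * h1 - h

lemma lt_mul_card_support_codeMap (hp : Odd p) (hF : Fintype.card F = p ^ (2 * s))
    (hd : 0 < d) (hs : s = d + 2 * d * j) (hl : l = d + 2 * d * k) (hsd : 3 * d ≤ s)
    (hd' : Nat.gcd (s + l) (2 * l) = 2 * d) (hls : l ≤ 2 * s) {t : F × F × F × ZMod p}
    (ht : t.1 ^ p ^ s = t.1) (ht0 : t ≠ 0) :
    (p - 2) * (p ^ (s - 1) * (p - 1) * (p ^ s + 1))
      < (p - 1) * (Finset.univ.filter fun x => codeMap p s l F t x ≠ 0).card := by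
  obtain ⟨a, b, c, h⟩ := t
  have hp2 := (Fact.out : p.Prime).two_le
  have hp3 : 3 ≤ p := by
    rcases hp with ⟨i, hi⟩
    omega
  have hpZ : (3 : ℤ) ≤ p := by exact_mod_cast hp3
  have key := weight_bound (T := levelDiff (quadForm p s l a b)) (d := d) (s := s)
    (Z := levelCard (codeMap p s l F (a, b, c, h)) 0) hp3 hd hsd ?_
  · have h1 := card_support_codeMap (s := s) (l := l) (a, b, c, h)
    have h2 := mul_designWeight (p := p) (s := s) (by omega)
    rw [hF] at h1
    zify at h1
    rw [← h1, add_sub_cancel_right] at key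
    zify [hp2, (by omega : 1 ≤ p)] at h2 ⊢
    refine lt_of_mul_lt_mul_left (a := (p : ℤ)) ?_ (by linarith)
    nlinarith
  · rcases mul_levelCard_codeMap_cases hp hF hd hs hl hd' hls (c := c) (h := h) ht ht0 with
      h1 | h1 | ⟨T, rfl, h1⟩
    · exact Or.inl h1
    · exact Or.inr (Or.inl (by exact_mod_cast h1))
    · exact Or.inr (Or.inr h1)

variable [DecidableEq F]

/-- The parameters of the codewords of the weight under consideration. -/
noncomputable def designParams (p s l : ℕ) [Fact p.Prime] (F : Type*) [Field F] [Fintype F]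
    [DecidableEq F] [Algebra (ZMod p) F] : Finset (F × F × F × ZMod p) :=
  Finset.univ.filter fun t => t.1 ^ p ^ s = t.1 ∧
    (Finset.univ.filter fun x => codeMap p s l F t x ≠ 0).card
      = p ^ (s - 1) * (p - 1) * (p ^ s + 1)

lemma mem_designParams {t : F × F × F × ZMod p} : t ∈ designParams p s l F ↔ t.1 ^ p ^ s = t.1 ∧
    (Finset.univ.filter fun x => codeMap p s l F t x ≠ 0).card
      = p ^ (s - 1) * (p - 1) * (p ^ s + 1) := by
  simp [designParams]

lemma designWeight_pos : 0 < p ^ (s - 1) * (p - 1) * (p ^ s + 1) := by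
  have hp0 := (Fact.out : p.Prime).pos
  have hp1 : 0 < p - 1 := by
    have := (Fact.out : p.Prime).two_le
    omega
  positivity

lemma levelDiff_of_mem_designParams (hp : Odd p) (hs0 : 0 < s) (hF : Fintype.card F = p ^ (2 * s))
    (hd : 0 < d) (hs : s = d + 2 * d * j) (hl : l = d + 2 * d * k)
    (hd' : Nat.gcd (s + l) (2 * l) = 2 * d) (hls : l ≤ 2 * s) {t : F × F × F × ZMod p}
    (ht : t ∈ designParams p s l F) :
    levelDiff (quadForm p s l t.1 t.2.1) = -(p : ℤ) ^ s := by
  obtain ⟨a, b, c, h⟩ := t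
  have hp3 : 3 ≤ p := by
    have := (Fact.out : p.Prime).two_le
    rcases hp with ⟨i, hi⟩
    omega
  rw [mem_designParams] at ht
  refine levelDiff_eq_of_mul_eq hp3 hs0 hd ((card_support_codeMap_eq_iff hs0 hF _).1 ht.2) ?_
  have ht0 : (a, b, c, h) ≠ 0 := by
    intro h0
    have h2 := ht.2
    simp only [h0, map_zero, Pi.zero_apply, ne_eq, not_true_eq_false, Finset.filter_false,
      Finset.card_empty] at h2
    exact designWeight_pos.ne h2
  rcases mul_levelCard_codeMap_cases hp hF hd hs hl hd' hls ht.1 ht0 with h1 | h1 | ⟨T, rfl, h1⟩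
  · exact Or.inl h1
  · exact Or.inr (Or.inl (by exact_mod_cast h1))
  · exact Or.inr (Or.inr h1)

lemma card_designParams (hp : Odd p) (hs0 : 0 < s) (hF : Fintype.card F = p ^ (2 * s)) (hd : 0 < d)
    (hs : s = d + 2 * d * j) (hl : l = d + 2 * d * k)
    (hd' : Nat.gcd (s + l) (2 * l) = 2 * d) (hls : l ≤ 2 * s) :
    (designParams p s l F).card
      = ((fixedPow p s F ×ˢ (Finset.univ : Finset F)).filter fun t =>
        levelDiff (quadForm p s l t.1 t.2) = -(p : ℤ) ^ s).card * p ^ (2 * s) := by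
  have hp0 := (Fact.out : p.Prime).pos
  have hP : (0 : ℤ) < (p : ℤ) ^ s := by positivity
  have hpZ : (0 : ℤ) < p := by exact_mod_cast hp0
  have huniq : ∀ a b c : F, a ^ p ^ s = a → levelDiff (quadForm p s l a b) = -(p : ℤ) ^ s →
      ∃ w, ∀ h, (a, b, c, h) ∈ designParams p s l F ↔ h = w := by
    intro a b c ha hT
    obtain ⟨w, hw⟩ := exists_mul_levelCard_codeMap hp hF hd hs hl hls ha hT c
    refine ⟨w, fun h => ?_⟩
    rw [mem_designParams, and_iff_right ha, card_support_codeMap_eq_iff hs0 hF, hw]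
    split_ifs with hh
    · simp only [hh, iff_true]
      ring
    · simp only [hh, iff_false]
      intro h'
      nlinarith
  rw [← hF, ← Finset.card_univ, ← Finset.card_product]
  refine Finset.card_nbij (fun t => ((t.1, t.2.1), t.2.2.1)) ?_ ?_ ?_
  · intro t ht
    rw [Finset.mem_coe] at ht
    simp only [Finset.coe_product, Set.mem_prod, Finset.mem_coe, Finset.mem_product,
      Finset.mem_filter, mem_fixedPow, Finset.mem_univ, and_true]
    exact ⟨(mem_designParams.1 ht).1,
      levelDiff_of_mem_designParams hp hs0 hF hd hs hl hd' hls ht⟩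
  · rintro ⟨a, b, c, h⟩ ht ⟨a', b', c', h'⟩ ht' he
    rw [Finset.mem_coe] at ht ht'
    simp only [Prod.mk.injEq] at he
    obtain ⟨⟨rfl, rfl⟩, rfl⟩ := he
    have hT := levelDiff_of_mem_designParams hp hs0 hF hd hs hl hd' hls ht
    obtain ⟨w, hw⟩ := huniq a b c (mem_designParams.1 ht).1 hT
    rw [(hw h).1 ht, (hw h').1 ht']
  · rintro ⟨⟨a, b⟩, c⟩ ht
    simp only [Finset.coe_product, Set.mem_prod, Finset.mem_coe, Finset.mem_product,
      Finset.mem_filter, mem_fixedPow, Finset.mem_univ, and_true] at ht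
    obtain ⟨w, hw⟩ := huniq a b c ht.1 ht.2
    exact ⟨(a, b, c, w), Finset.mem_coe.2 ((hw w).2 rfl), rfl⟩

/-- The distinct supports of the codewords of the weight under consideration. -/
noncomputable def designBlocks (p s l : ℕ) [Fact p.Prime] (F : Type*) [Field F] [Fintype F]
    [DecidableEq F] [Algebra (ZMod p) F] : Finset (Finset F) :=
  (designParams p s l F).image fun t => Finset.univ.filter fun x => codeMap p s l F t x ≠ 0

lemma mul_card_designBlocks (hp : Odd p) (hF : Fintype.card F = p ^ (2 * s))
    (hd : 0 < d) (hs : s = d + 2 * d * j) (hl : l = d + 2 * d * k) (hsd : 3 * d ≤ s)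
    (hd' : Nat.gcd (s + l) (2 * l) = 2 * d) (hls : l ≤ 2 * s) :
    (p - 1) * (designBlocks p s l F).card = (designParams p s l F).card := by
  refine mul_card_image_support (codeMap p s l F) designWeight_pos
    (fun t ht => (mem_designParams.1 ht).2) ?_ ?_
  · intro r t ht
    rw [mem_designParams] at ht ⊢
    refine ⟨?_, ?_⟩
    · rw [Prod.smul_fst, Algebra.smul_def, mul_pow, ht.1, algebraMap_pow_prime_pow]
    · rw [← ht.2]
      congr 1
      ext x
      simp
  · intro t ht t' ht' hne
    refine lt_mul_card_support_codeMap hp hF hd hs hl hsd hd' hls ?_ (sub_ne_zero.2 hne)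
    rw [Prod.fst_sub, sub_pow_prime_pow p, (mem_designParams.1 ht).1, (mem_designParams.1 ht').1]

lemma filter_affine_mem_designBlocks (hp : Odd p) (hF : Fintype.card F = p ^ (2 * s)) (hd : 0 < d)
    (hs : s = d + 2 * d * j) (hl : l = d + 2 * d * k) (hls : l ≤ 2 * s) {u : F} (hu : u ≠ 0)
    (v : F) {S : Finset F} (hS : S ∈ designBlocks p s l F) :
    (Finset.univ.filter fun z => u * z + v ∈ S) ∈ designBlocks p s l F := by
  obtain ⟨⟨a, b, c, h⟩, ht, rfl⟩ := Finset.mem_image.1 hS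
  rw [mem_designParams] at ht
  obtain ⟨t', ht', he⟩ := codeMap_comp_affine hp hF hd hs hl hls ht.1 b c h u v
  refine Finset.mem_image.2 ⟨t', mem_designParams.2 ⟨ht', ?_⟩, ?_⟩
  · rw [← ht.2]
    refine Finset.card_bij (fun x _ => u * x + v) ?_ ?_ ?_
    · intro x hx
      simpa [he] using hx
    · intro x _ y _ hxy
      exact mul_left_cancel₀ hu (add_right_cancel hxy)
    · intro y hy
      have hy' : u * (u⁻¹ * (y - v)) + v = y := by
        rw [mul_inv_cancel_left₀ hu, sub_add_cancel]
      exact ⟨u⁻¹ * (y - v), by simpa [he, hy'] using hy, hy'⟩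
  · ext x
    simp [he]

lemma card_filter_designBlocks (hp : Odd p) (hF : Fintype.card F = p ^ (2 * s)) (hd : 0 < d)
    (hs : s = d + 2 * d * j) (hl : l = d + 2 * d * k) (hls : l ≤ 2 * s) {x y : F} (hxy : x ≠ y) :
    ((designBlocks p s l F).filter fun S => x ∈ S ∧ y ∈ S).card
        * (p ^ (2 * s) * (p ^ (2 * s) - 1))
      = (designBlocks p s l F).card * ((p ^ (s - 1) * (p - 1) * (p ^ s + 1))
        * (p ^ (s - 1) * (p - 1) * (p ^ s + 1) - 1)) := by
  rw [← hF]
  refine card_filter_pair_mul ?_ ?_ hxy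
  · intro S hS
    obtain ⟨t, ht, rfl⟩ := Finset.mem_image.1 hS
    exact (mem_designParams.1 ht).2
  · intro x y x' y' h h'
    have h0 : x - y ≠ 0 := sub_ne_zero.2 h
    have hu : (x' - y') / (x - y) ≠ 0 := div_ne_zero (sub_ne_zero.2 h') h0
    refine ⟨(Equiv.mulLeft₀ _ hu).trans (Equiv.addRight (x' - (x' - y') / (x - y) * x)),
      ?_, ?_, fun S hS => filter_affine_mem_designBlocks hp hF hd hs hl hls hu _ hS⟩
    · simp
    · change (x' - y') / (x - y) * y + (x' - (x' - y') / (x - y) * x) = y'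
      field_simp
      ring

end WeightCount

lemma trp_two_mul {p s : ℕ} {F : Type} [Field F] {z : F}
    (hz : z ^ p ^ s = z) : trp p (2 * s) z = 2 * trp p s z := by
  rw [trp, two_mul s, Finset.sum_range_add, trp, two_mul]
  congr 1
  refine Finset.sum_congr rfl fun i _ => ?_
  rw [pow_add, pow_mul, hz]

section TraceComparison

variable {p s l : ℕ} [Fact p.Prime] {F : Type} [Field F] [Fintype F] [Algebra (ZMod p) F]

lemma trp_eq_algebraMap_trace (hF : Fintype.card F = p ^ (2 * s)) (z : F) :
    trp p (2 * s) z = algebraMap (ZMod p) F (Algebra.trace (ZMod p) F z) := by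
  have hrank : Module.finrank (ZMod p) F = 2 * s := by
    have h := Module.card_eq_pow_finrank (K := ZMod p) (V := F)
    rw [hF, ZMod.card] at h
    exact (Nat.pow_right_injective (Fact.out : p.Prime).two_le h).symm
  rw [FiniteField.algebraMap_trace_eq_sum_pow, hrank, Nat.card_zmod, trp]

lemma cword_eq_algebraMap_codeMap (hp : Odd p) (hF : Fintype.card F = p ^ (2 * s)) {a : F}
    (ha : a ^ p ^ s = a) (b c : F) (h : ZMod p) (x : F) [CharP F p] :
    cword p s l a b c h x = algebraMap (ZMod p) F (codeMap p s l F (a, b, c, h) x) := by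
  have h2 : (2 : F) ≠ 0 := two_ne_zero_of_odd (p := p) hp
  have hx : (x ^ (p ^ s + 1)) ^ p ^ s = x ^ (p ^ s + 1) := by
    rw [pow_succ, mul_pow, ← pow_mul, ← pow_add p, ← two_mul, pow_prime_pow_card hF, mul_comm]
  have h1 : trp p s (a * x ^ (p ^ s + 1))
      = algebraMap (ZMod p) F (Algebra.trace (ZMod p) F (2⁻¹ * a * x ^ (p ^ s + 1))) := by
    have h5 : 2⁻¹ * a * x ^ (p ^ s + 1) = (2⁻¹ : ZMod p) • (a * x ^ (p ^ s + 1)) := by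
      rw [Algebra.smul_def, map_inv₀, map_ofNat, mul_assoc]
    rw [h5, map_smul, smul_eq_mul, map_mul, ← trp_eq_algebraMap_trace hF,
      trp_two_mul (by rw [mul_pow, ha, hx]), map_inv₀, map_ofNat, inv_mul_cancel_left₀ h2]
  have h3 : (ZMod.cast h : F) = algebraMap (ZMod p) F h := by
    exact RingHom.congr_fun (Subsingleton.elim (ZMod.castHom dvd_rfl F) (algebraMap (ZMod p) F)) h
  rw [cword, h1, h3, trp_eq_algebraMap_trace hF, codeMap_apply, quadForm]
  simp only [map_add]
  ring

end TraceComparison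

section Conclusion

lemma suppw_eq_filter_codeMap {p s l : ℕ} [Fact p.Prime] {F : Type} [Field F] [Fintype F]
    [DecidableEq F] [CharP F p] [Algebra (ZMod p) F] (hp : Odd p)
    (hF : Fintype.card F = p ^ (2 * s)) {a : F} (ha : a ^ p ^ s = a) (b c : F) (h : ZMod p) :
    suppw p s l a b c h = Finset.univ.filter fun x => codeMap p s l F (a, b, c, h) x ≠ 0 := by
  simp only [suppw, cword_eq_algebraMap_codeMap hp hF ha, ne_eq,
    FaithfulSMul.algebraMap_eq_zero_iff]

lemma image_suppw_eq_designBlocks {p s l : ℕ} [Fact p.Prime] {F : Type} [Field F] [Fintype F]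
    [DecidableEq F] [CharP F p] [Algebra (ZMod p) F] (hp : Odd p)
    (hF : Fintype.card F = p ^ (2 * s)) :
    (((Finset.univ : Finset (F × F × F × ZMod p)).filter fun t =>
        t.1 ^ p ^ s = t.1 ∧ (suppw p s l t.1 t.2.1 t.2.2.1 t.2.2.2).card
            = p ^ (s - 1) * (p - 1) * (p ^ s + 1)).image
        fun t => suppw p s l t.1 t.2.1 t.2.2.1 t.2.2.2) = designBlocks p s l F := by
  have hmem : ((Finset.univ : Finset (F × F × F × ZMod p)).filter fun t =>
      t.1 ^ p ^ s = t.1 ∧ (suppw p s l t.1 t.2.1 t.2.2.1 t.2.2.2).card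
        = p ^ (s - 1) * (p - 1) * (p ^ s + 1)) = designParams p s l F := by
    refine Finset.filter_congr fun t _ => and_congr_right fun ht => ?_
    rw [suppw_eq_filter_codeMap hp hF ht]
  rw [hmem, designBlocks]
  refine Finset.image_congr fun t ht => ?_
  exact suppw_eq_filter_codeMap hp hF (mem_designParams.1 ht).1 _ _ _

lemma three_mul_le_of_ne {s l d j k : ℕ} (hd : 0 < d) (hs : s = d + 2 * d * j)
    (hl : l = d + 2 * d * k) (hls : l ≠ s) (hl2 : l < 2 * s) : 3 * d ≤ s := by
  rcases Nat.eq_zero_or_pos j with rfl | hj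
  · rcases Nat.eq_zero_or_pos k with rfl | hk
    · exact absurd (hl.trans hs.symm) hls
    · have : 2 * d * 1 ≤ 2 * d * k := Nat.mul_le_mul_left _ hk
      omega
  · have : 2 * d * 1 ≤ 2 * d * j := Nat.mul_le_mul_left _ hj
    omega

lemma multiplicity_eq {p s d N B A : ℕ} (hp : 2 ≤ p) (hd : 0 < d) (hsd : 3 * d ≤ s)
    (h1 : N * (p ^ (2 * s) * (p ^ (2 * s) - 1)) = B * ((p ^ (s - 1) * (p - 1) * (p ^ s + 1))
        * (p ^ (s - 1) * (p - 1) * (p ^ s + 1) - 1)))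
    (h2 : (p - 1) * B = A * p ^ (2 * s))
    (h3 : (A : ℤ) * (((p : ℤ) ^ d + 1) * ((p : ℤ) ^ (2 * d) - 1))
      = ((p : ℤ) ^ s - 1) * ((p : ℤ) ^ (3 * d) * ((p : ℤ) ^ (2 * s) + (p : ℤ) ^ s + 1)
        - (p : ℤ) ^ s * ((p : ℤ) ^ s * ((p : ℤ) ^ d + 1) + (p : ℤ) ^ (2 * d)))) :
    (N : ℚ) = (p : ℚ) ^ (s + 3 * d - 1)
          * ((p : ℚ) ^ (s - 1) * ((p : ℚ) - 1) * ((p : ℚ) ^ s + 1) - 1)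
          * ((p : ℚ) ^ (2 * s) - (p : ℚ) ^ (2 * s - 2 * d) - (p : ℚ) ^ (2 * s - 3 * d)
            + (p : ℚ) ^ s - (p : ℚ) ^ (s - d) + 1)
          / (((p : ℚ) ^ d + 1) * ((p : ℚ) ^ (2 * d) - 1)) := by
  have hi : 1 ≤ p ^ (s - 1) * (p - 1) * (p ^ s + 1) := by
    have hp1 : 0 < p - 1 := by omega
    have : 0 < p := by omega
    exact Nat.succ_le_of_lt (by positivity)
  have hq : 1 ≤ p ^ (2 * s) := Nat.one_le_pow _ _ (by omega)
  replace h1 := congrArg (Nat.cast : ℕ → ℚ) h1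
  replace h2 := congrArg (Nat.cast : ℕ → ℚ) h2
  replace h3 := congrArg (Int.cast : ℤ → ℚ) h3
  push_cast [Nat.cast_sub hi, Nat.cast_sub hq, Nat.cast_sub (by omega : 1 ≤ p)] at h1 h2 h3
  have hpQ : (2 : ℚ) ≤ p := by exact_mod_cast hp
  have hP : 1 < (p : ℚ) ^ s := one_lt_pow₀ (by linarith) (by omega)
  have hD : 1 < (p : ℚ) ^ d := one_lt_pow₀ (by linarith) (by omega)
  have hD2 : 1 < (p : ℚ) ^ (2 * d) := one_lt_pow₀ (by linarith) (by omega)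
  rw [eq_div_iff (mul_ne_zero (by linarith) (by linarith))]
  have e1 : (p : ℚ) ^ s = p ^ (s - 3 * d) * (p ^ d) ^ 3 := by
    rw [← pow_mul, ← pow_add]
    congr 1
    omega
  have e2 : (p : ℚ) ^ (2 * s) = (p ^ s) ^ 2 := by rw [← pow_mul, mul_comm]
  have e3 : (p : ℚ) ^ (2 * d) = (p ^ d) ^ 2 := by rw [← pow_mul, mul_comm]
  have e4 : (p : ℚ) ^ (3 * d) = (p ^ d) ^ 3 := by rw [← pow_mul, mul_comm]
  have e5 : (p : ℚ) ^ (s + 3 * d - 1) = p ^ (s - 1) * (p ^ d) ^ 3 := by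
    rw [← pow_mul, ← pow_add]
    congr 1
    omega
  have e6 : (p : ℚ) ^ (2 * s - 2 * d) = (p ^ (s - 3 * d)) ^ 2 * (p ^ d) ^ 4 := by
    rw [← pow_mul, ← pow_mul, ← pow_add]
    congr 1
    omega
  have e7 : (p : ℚ) ^ (2 * s - 3 * d) = (p ^ (s - 3 * d)) ^ 2 * (p ^ d) ^ 3 := by
    rw [← pow_mul, ← pow_mul, ← pow_add]
    congr 1
    omega
  have e8 : (p : ℚ) ^ (s - d) = p ^ (s - 3 * d) * (p ^ d) ^ 2 := by
    rw [← pow_mul, ← pow_add]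
    congr 1
    omega
  rw [e2] at h1 h2 h3
  rw [e3, e4] at h3
  rw [e2, e3, e5, e6, e7, e8]
  have hne : ((p : ℚ) ^ s) ^ 2 * (((p : ℚ) ^ s) ^ 2 - 1) ≠ 0 :=
    mul_ne_zero (by positivity) (by nlinarith)
  refine mul_left_cancel₀ hne ?_
  generalize (p : ℚ) ^ (s - 1) = R at *
  generalize (p : ℚ) ^ (s - 3 * d) = E at *
  generalize (p : ℚ) ^ d = D at *
  generalize (p : ℚ) ^ s = P at *
  have key : P ^ 2 * (P ^ 2 - 1) * (N * ((D + 1) * (D ^ 2 - 1)))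
      = P ^ 2 * (P ^ 2 - 1) * (R * (R * (p - 1) * (P + 1) - 1)
        * (D ^ 3 * (P ^ 2 + P + 1) - P * (P * (D + 1) + D ^ 2))) := by
    linear_combination (D + 1) * (D ^ 2 - 1) * h1
      + R * (P + 1) * (R * (p - 1) * (P + 1) - 1) * (D + 1) * (D ^ 2 - 1) * h2
      + R * (P + 1) * (R * (p - 1) * (P + 1) - 1) * P ^ 2 * h3
  rw [key]
  subst e1
  ring

end Conclusion

theorem stmt17 (p s l : ℕ) [Fact p.Prime] (F : Type) [Field F] [Fintype F] [DecidableEq F]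
    [CharP F p] (hodd : Odd p) (hs : 2 ≤ s) (hl1 : 1 ≤ l) (hls : l ≠ s)
    (hl2 : l ≤ 2 * s - 1) (hF : Fintype.card F = p ^ (2 * s)) (d : ℕ)
    (hd : Nat.gcd s l = d) (hd' : Nat.gcd (s + l) (2 * l) = 2 * d) :
    (∀ S ∈ (((Finset.univ : Finset (F × F × F × ZMod p)).filter fun t =>
        t.1 ^ p ^ s = t.1 ∧ (suppw p s l t.1 t.2.1 t.2.2.1 t.2.2.2).card
            = p ^ (s - 1) * (p - 1) * (p ^ s + 1)).image
        fun t => suppw p s l t.1 t.2.1 t.2.2.1 t.2.2.2),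
      S.card = p ^ (s - 1) * (p - 1) * (p ^ s + 1)) ∧
    ∀ x y : F, x ≠ y →
      (((((Finset.univ : Finset (F × F × F × ZMod p)).filter fun t =>
        t.1 ^ p ^ s = t.1 ∧ (suppw p s l t.1 t.2.1 t.2.2.1 t.2.2.2).card
            = p ^ (s - 1) * (p - 1) * (p ^ s + 1)).image
        fun t => suppw p s l t.1 t.2.1 t.2.2.1 t.2.2.2).filter
        fun S => x ∈ S ∧ y ∈ S).card : ℚ)
        = (p : ℚ) ^ (s + 3 * d - 1) * ((p : ℚ) ^ (s - 1) * ((p : ℚ) - 1) * ((p : ℚ) ^ s + 1) - 1)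
          * ((p : ℚ) ^ (2 * s) - (p : ℚ) ^ (2 * s - 2 * d) - (p : ℚ) ^ (2 * s - 3 * d)
            + (p : ℚ) ^ s - (p : ℚ) ^ (s - d) + 1)
          / (((p : ℚ) ^ d + 1) * ((p : ℚ) ^ (2 * d) - 1)) := by
  let _ := ZMod.algebra F p
  obtain ⟨j, k, hsj, hlk⟩ := exists_eq_add_mul_of_gcd hl1 hd hd'
  have hd0 : 0 < d := hd ▸ Nat.gcd_pos_of_pos_right s hl1
  have hsd := three_mul_le_of_ne hd0 hsj hlk hls (by omega)
  have hl2' : l ≤ 2 * s := by omega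
  rw [image_suppw_eq_designBlocks hodd hF]
  refine ⟨fun S hS => ?_, fun x y hxy => ?_⟩
  · obtain ⟨t, ht, rfl⟩ := Finset.mem_image.1 hS
    exact (mem_designParams.1 ht).2
  · exact multiplicity_eq (Fact.out : p.Prime).two_le hd0 hsd
      (card_filter_designBlocks hodd hF hd0 hsj hlk hl2' hxy)
      ((mul_card_designBlocks hodd hF hd0 hsj hlk hsd hd' hl2').trans
        (card_designParams hodd (by omega) hF hd0 hsj hlk hd' hl2'))
      (card_levelDiff_eq hodd (by omega) hF hd0 hsj hlk hd hd' hl2')
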